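/- arXiv:1311.6607 — 9 statements merged into one kernel-verified Lean document; each statement's English description precedes it below -/
import Mathlib

section
/- For every α ∈ (0,1) and every τ ∈ (−1,0], the function t ↦ (|1−t|^τ + (1+t)^τ − 2)/t^{1+2α} is Lebesgue integrable on the interval (0,∞). -/
open MeasureTheory Real Set

lemma intervalIntegrable_abs_rpow {r : ℝ} (hr : -1 < r) (a b : ℝ) :
    IntervalIntegrable (fun x : ℝ => |x| ^ r) volume a b := by
  refine intervalIntegrable_of_even (by simp) ?_ (by simp) (by simp)
  intro c hc
  refine (intervalIntegral.intervalIntegrable_rpow' hr (a := 0) (b := c)).congr ?_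
  intro x hx
  rw [uIoc_of_le hc.le] at hx
  simp [abs_of_pos hx.1]

lemma abs_one_sub_rpow_add_one_add_rpow_sub_two_le {τ t : ℝ} (hτ : -1 ≤ τ) (hτ' : τ ≤ 0)
    (ht : 0 ≤ t) (ht' : t ≤ 1 / 2) :
    |(1 - t) ^ τ + (1 + t) ^ τ - 2| ≤ 4 * t ^ 2 := by
  obtain ⟨s, rfl⟩ : ∃ s, τ = -s := ⟨-τ, by ring⟩
  have h1 : (0 : ℝ) < 1 - t := by linarith
  have h2 : (0 : ℝ) < 1 + t := by linarith
  have hx := rpow_pos_of_pos h2 s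
  have hy := rpow_pos_of_pos h1 s
  have hx' : (1 + t) ^ s ≤ 1 + s * t :=
    rpow_one_add_le_one_add_mul_self (by linarith) (by linarith) (by linarith)
  have hy' : (1 - t) ^ s ≤ 1 - s * t := by
    have := rpow_one_add_le_one_add_mul_self (s := -t) (p := s) (by linarith) (by linarith)
      (by linarith)
    simpa [← sub_eq_add_neg] using this
  have hxy : 1 - t ^ 2 ≤ (1 - t) ^ s * (1 + t) ^ s := by
    rw [← mul_rpow h1.le h2.le, show (1 - t) * (1 + t) = 1 - t ^ 2 by ring]
    have := rpow_le_rpow_of_exponent_ge (x := 1 - t ^ 2) (by nlinarith) (by nlinarith)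
      (show s ≤ 1 by linarith)
    simpa using this
  rw [rpow_neg h1.le, rpow_neg h2.le]
  generalize (1 + t) ^ s = x at *
  generalize (1 - t) ^ s = y at *
  have key : y⁻¹ + x⁻¹ = (x + y) / (y * x) := by field_simp
  have hp : 0 < y * x := mul_pos hy hx
  rw [key, abs_le]
  constructor
  · have : 2 ≤ (x + y) / (y * x) := by
      rw [le_div_iff₀ hp]
      nlinarith [sq_nonneg (x - y)]
    nlinarith [sq_nonneg t]
  · have : (x + y) / (y * x) ≤ 2 + 4 * t ^ 2 := by
      rw [div_le_iff₀ hp]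
      have ht2 : t ^ 2 ≤ 1 / 4 := by nlinarith
      nlinarith [mul_le_mul_of_nonneg_left hxy (show 0 ≤ 2 + 4 * t ^ 2 by positivity),
        mul_nonneg (sq_nonneg t) (show 0 ≤ 1 / 4 - t ^ 2 by linarith)]
    linarith

lemma abs_rpow_add_rpow_sub_two_le {τ t a : ℝ} (hτ : τ ≤ 0) (ht : 0 ≤ t) (ha : 0 ≤ a) :
    |a + (1 + t) ^ τ - 2| ≤ a + 2 := by
  have h1 : (1 + t) ^ τ ≤ 1 := rpow_le_one_of_one_le_of_nonpos (by linarith) hτ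
  have h2 : 0 ≤ (1 + t) ^ τ := by positivity
  rw [abs_le]
  constructor <;> linarith

theorem integrable_c_integrand (α τ : ℝ) (hα : α ∈ Set.Ioo (0:ℝ) 1)
    (hτ : τ ∈ Set.Ioc (-1:ℝ) 0) :
    MeasureTheory.IntegrableOn
      (fun t : ℝ => (|1 - t| ^ τ + (1 + t) ^ τ - 2) / t ^ (1 + 2 * α))
      (Set.Ioi (0:ℝ)) := by
  obtain ⟨hα0, hα1⟩ := hα
  obtain ⟨hτ0, hτ1⟩ := hτ
  have hmeas : Measurable
      (fun t : ℝ => (|1 - t| ^ τ + (1 + t) ^ τ - 2) / t ^ (1 + 2 * α)) := by fun_prop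
  have hnorm : ∀ t : ℝ, 0 < t → ‖(|1 - t| ^ τ + (1 + t) ^ τ - 2) / t ^ (1 + 2 * α)‖ =
      |(|1 - t| ^ τ + (1 + t) ^ τ - 2)| * t ^ (-(1 + 2 * α)) := by
    intro t ht
    rw [norm_eq_abs, abs_div, abs_of_pos (rpow_pos_of_pos ht _), rpow_neg ht.le, div_eq_mul_inv]
  have near_zero : IntegrableOn
      (fun t : ℝ => (|1 - t| ^ τ + (1 + t) ^ τ - 2) / t ^ (1 + 2 * α)) (Ioc 0 (1 / 2)) := by
    have hint : IntegrableOn (fun t : ℝ => 4 * t ^ (1 - 2 * α)) (Ioc 0 (1 / 2)) :=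
      ((intervalIntegrable_iff_integrableOn_Ioc_of_le (by norm_num)).1
        (intervalIntegral.intervalIntegrable_rpow' (by linarith))).const_mul 4
    refine Integrable.mono' hint hmeas.aestronglyMeasurable ?_
    filter_upwards [ae_restrict_mem measurableSet_Ioc] with t ht
    rw [hnorm t ht.1, abs_of_nonneg (show (0 : ℝ) ≤ 1 - t by linarith [ht.2])]
    have hpow : t ^ (1 - 2 * α) = t ^ 2 * t ^ (-(1 + 2 * α)) := by
      rw [← rpow_natCast t 2, ← rpow_add ht.1]
      congr 1
      push_cast
      ring
    rw [hpow, ← mul_assoc]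
    exact mul_le_mul_of_nonneg_right
      (abs_one_sub_rpow_add_one_add_rpow_sub_two_le hτ0.le hτ1 ht.1.le ht.2)
      (rpow_nonneg ht.1.le _)
  have near_one : IntegrableOn
      (fun t : ℝ => (|1 - t| ^ τ + (1 + t) ^ τ - 2) / t ^ (1 + 2 * α)) (Ioc (1 / 2) 2) := by
    have hint : IntegrableOn
        (fun t : ℝ => (|1 - t| ^ τ + 2) * (1 / 2 : ℝ) ^ (-(1 + 2 * α))) (Ioc (1 / 2) 2) := by
      have h := (intervalIntegrable_abs_rpow hτ0 (1 - 1 / 2) (1 - 2)).comp_sub_left 1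
      simp only [sub_sub_cancel] at h
      exact (((intervalIntegrable_iff_integrableOn_Ioc_of_le (by norm_num)).1 h).add
        (integrableOn_const (by simp))).mul_const _
    refine Integrable.mono' hint hmeas.aestronglyMeasurable ?_
    filter_upwards [ae_restrict_mem measurableSet_Ioc] with t ht
    have ht0 : 0 < t := by linarith [ht.1]
    rw [hnorm t ht0]
    exact mul_le_mul (abs_rpow_add_rpow_sub_two_le hτ1 ht0.le (by positivity))
      (rpow_le_rpow_of_nonpos (by norm_num) ht.1.le (by linarith)) (by positivity) (by positivity)
  have near_top : IntegrableOn
      (fun t : ℝ => (|1 - t| ^ τ + (1 + t) ^ τ - 2) / t ^ (1 + 2 * α)) (Ioi 2) := by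
    have hint : IntegrableOn (fun t : ℝ => 3 * t ^ (-(1 + 2 * α))) (Ioi 2) :=
      (integrableOn_Ioi_rpow_of_lt (by linarith) (by norm_num)).const_mul 3
    refine Integrable.mono' hint hmeas.aestronglyMeasurable ?_
    filter_upwards [ae_restrict_mem measurableSet_Ioi] with t ht
    have ht2 : 2 < t := ht
    have ht0 : 0 < t := by linarith
    rw [hnorm t ht0]
    have h1 : |1 - t| ^ τ ≤ 1 :=
      rpow_le_one_of_one_le_of_nonpos (by rw [abs_of_neg] <;> linarith) hτ1
    refine mul_le_mul_of_nonneg_right ?_ (by positivity)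
    linarith [abs_rpow_add_rpow_sub_two_le hτ1 ht0.le (show 0 ≤ |1 - t| ^ τ by positivity)]
  rw [← Ioc_union_Ioi_eq_Ioi (show (0 : ℝ) ≤ 1 / 2 by norm_num),
    ← Ioc_union_Ioi_eq_Ioi (show (1 / 2 : ℝ) ≤ 2 by norm_num)]
  exact near_zero.union (near_one.union near_top)
end

section
/- For every α ∈ (0,1), c(α,τ) tends to +∞ as τ tends to −1 from the right, i.e. lim_{τ→−1⁺} c(α,τ) = +∞. -/
open MeasureTheory Real Set Filter

noncomputable def c (α τ : ℝ) : ℝ :=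
  ∫ t in Set.Ioi (0:ℝ), (|1 - t| ^ τ + (1 + t) ^ τ - 2) / t ^ (1 + 2 * α)

/-- For `-1 < τ`, the function `t ↦ |1 - t| ^ τ` is integrable around its singularity. -/
lemma intervalIntegrable_abs_one_sub_rpow {τ : ℝ} (hτ : -1 < τ) :
    IntervalIntegrable (fun t : ℝ => |1 - t| ^ τ) volume (1 / 2) 2 := by
  have h1 : IntervalIntegrable (fun t : ℝ => |1 - t| ^ τ) volume (1 / 2) 1 := by
    have h := (intervalIntegral.intervalIntegrable_rpow' (a := 1 / 2) (b := 0) hτ).comp_sub_left 1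
    norm_num at h
    refine h.congr ?_
    intro t ht
    rw [uIoc_of_le (by norm_num)] at ht
    simp only [abs_of_nonneg (sub_nonneg.2 ht.2)]
  have h2 : IntervalIntegrable (fun t : ℝ => |1 - t| ^ τ) volume 1 2 := by
    have h := (intervalIntegral.intervalIntegrable_rpow' (a := 0) (b := 1) hτ).comp_sub_right 1
    norm_num at h
    refine h.congr ?_
    intro t ht
    rw [uIoc_of_le (by norm_num)] at ht
    simp only [abs_sub_comm 1 t, abs_of_nonneg (sub_nonneg.2 ht.1.le)]
  exact h1.trans h2

lemma two_le_rpow_one_sub_add_rpow_one_add {τ t : ℝ} (hτ : τ ≤ 0) (ht0 : 0 < t) (ht1 : t < 1) :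
    2 ≤ (1 - t) ^ τ + (1 + t) ^ τ := by
  have hx : 0 < (1 - t) ^ τ := rpow_pos_of_pos (by linarith) _
  have hy : 0 < (1 + t) ^ τ := rpow_pos_of_pos (by linarith) _
  have h : 1 ≤ (1 - t) ^ τ * (1 + t) ^ τ := by
    rw [← mul_rpow (by linarith) (by linarith)]
    exact one_le_rpow_of_pos_of_le_one_of_nonpos (by nlinarith) (by nlinarith) hτ
  nlinarith [sq_nonneg ((1 - t) ^ τ - (1 + t) ^ τ)]

lemma rpow_le_one_add_neg_mul_inv_sub_one {τ x : ℝ} (hτ : -1 ≤ τ) (hτ0 : τ ≤ 0) (hx : 0 < x) :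
    x ^ τ ≤ 1 + -τ * (x⁻¹ - 1) := by
  have h := rpow_one_add_le_one_add_mul_self (s := x⁻¹ - 1) (p := -τ)
    (by linarith [inv_pos.2 hx]) (by linarith) (by linarith)
  rwa [add_sub_cancel, inv_rpow hx.le, rpow_neg hx.le, inv_inv] at h

lemma rpow_one_sub_add_rpow_one_add_sub_two_le {τ t : ℝ} (hτ : -1 ≤ τ) (hτ0 : τ ≤ 0)
    (ht0 : 0 < t) (ht1 : t ≤ 1 / 2) :
    (1 - t) ^ τ + (1 + t) ^ τ - 2 ≤ 4 * t ^ 2 := by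
  have h1 := rpow_le_one_add_neg_mul_inv_sub_one hτ hτ0 (x := 1 - t) (by linarith)
  have h2 := rpow_le_one_add_neg_mul_inv_sub_one hτ hτ0 (x := 1 + t) (by linarith)
  have hs : (1 - t)⁻¹ - 1 + ((1 + t)⁻¹ - 1) = 2 * t ^ 2 / (1 - t ^ 2) := by
    have : 1 - t ≠ 0 := by linarith
    have : 1 + t ≠ 0 := by linarith
    have : 1 - t ^ 2 ≠ 0 := by nlinarith
    field_simp
    ring
  have hq : 0 < 1 - t ^ 2 := by nlinarith
  have hle : 2 * t ^ 2 / (1 - t ^ 2) ≤ 4 * t ^ 2 := by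
    rw [div_le_iff₀ hq]
    nlinarith [mul_nonneg (sq_nonneg t) (by nlinarith : (0:ℝ) ≤ 1 - 2 * t ^ 2)]
  have hnn : 0 ≤ 2 * t ^ 2 / (1 - t ^ 2) := by positivity
  nlinarith

lemma integrableOn_integrand {α τ : ℝ} (hα : α ∈ Ioo (0:ℝ) 1) (hτ : -1 < τ) (hτ0 : τ ≤ 0) :
    IntegrableOn (fun t : ℝ => (|1 - t| ^ τ + (1 + t) ^ τ - 2) / t ^ (1 + 2 * α)) (Ioi 0) := by
  obtain ⟨hα0, hα1⟩ := hα
  have hm : Measurable fun t : ℝ => (|1 - t| ^ τ + (1 + t) ^ τ - 2) / t ^ (1 + 2 * α) := by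
    fun_prop
  have hnear : IntegrableOn
      (fun t : ℝ => (|1 - t| ^ τ + (1 + t) ^ τ - 2) / t ^ (1 + 2 * α)) (Ioc 0 (1 / 2)) := by
    have hg : IntegrableOn (fun t : ℝ => 4 * t ^ (1 - 2 * α)) (Ioc 0 (1 / 2)) :=
      ((intervalIntegrable_iff_integrableOn_Ioc_of_le (by norm_num)).1
        (intervalIntegral.intervalIntegrable_rpow' (by linarith))).const_mul 4
    refine hg.mono' hm.aestronglyMeasurable ?_
    filter_upwards [ae_restrict_mem measurableSet_Ioc] with t ht
    have hp : 0 < t ^ (1 + 2 * α) := rpow_pos_of_pos ht.1 _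
    have h1 := two_le_rpow_one_sub_add_rpow_one_add hτ0 ht.1 (by linarith [ht.2])
    have h2 := rpow_one_sub_add_rpow_one_add_sub_two_le hτ.le hτ0 ht.1 ht.2
    rw [abs_of_pos (by linarith [ht.2] : 0 < 1 - t), norm_of_nonneg (div_nonneg (by linarith) hp.le),
      div_le_iff₀ hp, mul_assoc, ← rpow_add ht.1]
    ring_nf at h2 ⊢
    simpa using h2
  have hmid : IntegrableOn
      (fun t : ℝ => (|1 - t| ^ τ + (1 + t) ^ τ - 2) / t ^ (1 + 2 * α)) (Ioc (1 / 2) 2) := by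
    have hpos : ∀ t ∈ uIcc (1 / 2 : ℝ) 2, 0 < t := fun t ht => by
      rw [uIcc_of_le (by norm_num)] at ht
      linarith [ht.1]
    have hc1 : ContinuousOn (fun t : ℝ => (1 + t) ^ τ - 2) (uIcc (1 / 2) 2) :=
      (ContinuousOn.rpow_const (by fun_prop)
        fun t ht => Or.inl (by linarith [hpos t ht])).sub continuousOn_const
    have hc2 : ContinuousOn (fun t : ℝ => (t ^ (1 + 2 * α))⁻¹) (uIcc (1 / 2) 2) :=
      (ContinuousOn.rpow_const continuousOn_id fun t ht => Or.inl (hpos t ht).ne').inv₀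
        fun t ht => (rpow_pos_of_pos (hpos t ht) _).ne'
    have h := ((intervalIntegrable_abs_one_sub_rpow hτ).add
      hc1.intervalIntegrable).mul_continuousOn hc2
    refine ((intervalIntegrable_iff_integrableOn_Ioc_of_le (by norm_num)).1 h).congr_fun
      (fun t _ => ?_) measurableSet_Ioc
    simp only [div_eq_mul_inv]
    ring
  have hfar : IntegrableOn
      (fun t : ℝ => (|1 - t| ^ τ + (1 + t) ^ τ - 2) / t ^ (1 + 2 * α)) (Ioi 2) := by
    have hg : IntegrableOn (fun t : ℝ => 2 * t ^ (-(1 + 2 * α))) (Ioi 2) :=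
      (integrableOn_Ioi_rpow_of_lt (by linarith) (by norm_num)).const_mul 2
    refine hg.mono' hm.aestronglyMeasurable ?_
    filter_upwards [ae_restrict_mem measurableSet_Ioi] with t ht
    have ht : 2 < t := ht
    have hp : 0 < t ^ (1 + 2 * α) := rpow_pos_of_pos (by linarith) _
    have h1 : |1 - t| ^ τ ≤ 1 := rpow_le_one_of_one_le_of_nonpos
      (by rw [abs_sub_comm, abs_of_pos] <;> linarith) hτ0
    have h2 : (1 + t) ^ τ ≤ 1 := rpow_le_one_of_one_le_of_nonpos (by linarith) hτ0
    have h3 : 0 ≤ |1 - t| ^ τ := by positivity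
    have h4 : 0 ≤ (1 + t) ^ τ := rpow_nonneg (by linarith) _
    rw [rpow_neg (by linarith), ← div_eq_mul_inv, norm_div, norm_of_nonneg hp.le]
    gcongr
    rw [norm_eq_abs, abs_le]
    constructor <;> linarith
  have h := (hnear.union hmid).union hfar
  rwa [Ioc_union_Ioc_eq_Ioc (by norm_num) (by norm_num), Ioc_union_Ioi_eq_Ioi (by norm_num)] at h

lemma le_c {α τ : ℝ} (hα : α ∈ Ioo (0:ℝ) 1) (hτ : -1 < τ) (hτ0 : τ ≤ 0) :
    (1 / 2) * (τ + 1)⁻¹ - 1 - 1 / α ≤ c α τ := by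
  have hf := integrableOn_integrand hα hτ hτ0
  obtain ⟨hα0, hα1⟩ := hα
  unfold c
  have hsplit : Ioi (0:ℝ) = (Ioc 0 (1 / 2) ∪ Ioc (1 / 2) 1) ∪ Ioi 1 := by
    rw [Ioc_union_Ioc_eq_Ioc (by norm_num) (by norm_num), Ioc_union_Ioi_eq_Ioi (by norm_num)]
  have hd1 : Disjoint (Ioc (0:ℝ) (1 / 2) ∪ Ioc (1 / 2) 1) (Ioi 1) := by
    rw [Ioc_union_Ioc_eq_Ioc (by norm_num) (by norm_num)]
    exact Ioc_disjoint_Ioi le_rfl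
  rw [hsplit] at hf ⊢
  have hfa := hf.left_of_union.left_of_union
  have hfb := hf.left_of_union.right_of_union
  have hfc := hf.right_of_union
  rw [setIntegral_union hd1 measurableSet_Ioi hf.left_of_union hfc,
    setIntegral_union (Ioc_disjoint_Ioc_of_le le_rfl) measurableSet_Ioc hfa hfb]
  have ha : 0 ≤ ∫ t in Ioc (0:ℝ) (1 / 2),
      (|1 - t| ^ τ + (1 + t) ^ τ - 2) / t ^ (1 + 2 * α) := by
    refine setIntegral_nonneg measurableSet_Ioc fun t ht => ?_
    rw [abs_of_pos (by linarith [ht.2] : 0 < 1 - t)]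
    have := two_le_rpow_one_sub_add_rpow_one_add hτ0 ht.1 (by linarith [ht.2])
    exact div_nonneg (by linarith) (rpow_nonneg ht.1.le _)
  have hb : (1 / 2) * (τ + 1)⁻¹ - 1 ≤ ∫ t in Ioc (1 / 2 : ℝ) 1,
      (|1 - t| ^ τ + (1 + t) ^ τ - 2) / t ^ (1 + 2 * α) := by
    have hi : IntervalIntegrable (fun t : ℝ => (1 - t) ^ τ) volume (1 / 2) 1 := by
      have h := (intervalIntegral.intervalIntegrable_rpow' (a := 1 / 2) (b := 0) hτ).comp_sub_left 1
      norm_num at h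
      simpa using h
    have hval : ∫ t in (1 / 2 : ℝ)..1, ((1 - t) ^ τ - 2) = (1 / 2) ^ (τ + 1) / (τ + 1) - 1 := by
      rw [intervalIntegral.integral_sub hi (by simp),
        intervalIntegral.integral_comp_sub_left (fun t : ℝ => t ^ τ), integral_rpow (Or.inl hτ),
        sub_self, zero_rpow (by linarith)]
      norm_num
    have hmono : ∫ t in Ioc (1 / 2 : ℝ) 1, ((1 - t) ^ τ - 2) ≤ ∫ t in Ioc (1 / 2 : ℝ) 1,
        (|1 - t| ^ τ + (1 + t) ^ τ - 2) / t ^ (1 + 2 * α) := by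
      rw [integral_Ioc_eq_integral_Ioo, integral_Ioc_eq_integral_Ioo]
      refine setIntegral_mono_on ?_ (hfb.mono_set Ioo_subset_Ioc_self) measurableSet_Ioo
        fun t ht => ?_
      · exact ((intervalIntegrable_iff_integrableOn_Ioc_of_le (by norm_num)).1
          (hi.sub (by simp))).mono_set Ioo_subset_Ioc_self
      · have h0 : 0 < t := by linarith [ht.1]
        rw [abs_of_pos (by linarith [ht.2] : 0 < 1 - t)]
        have h1 := two_le_rpow_one_sub_add_rpow_one_add hτ0 h0 ht.2
        have hp : 0 < t ^ (1 + 2 * α) := rpow_pos_of_pos h0 _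
        have hp1 : t ^ (1 + 2 * α) ≤ 1 := rpow_le_one h0.le ht.2.le (by linarith)
        have h2 : 0 ≤ (1 + t) ^ τ := rpow_nonneg (by linarith) _
        rw [le_div_iff₀ hp]
        nlinarith
    rw [← intervalIntegral.integral_of_le (by norm_num), hval] at hmono
    refine le_trans ?_ hmono
    have : (1 / 2 : ℝ) ≤ (1 / 2) ^ (τ + 1) := by
      simpa using rpow_le_rpow_of_exponent_ge (x := 1 / 2) (y := 1) (z := τ + 1)
        (by norm_num) (by norm_num) (by linarith)
    have hinv : 0 < (τ + 1)⁻¹ := inv_pos.2 (by linarith)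
    rw [div_eq_mul_inv ((1 / 2 : ℝ) ^ (τ + 1))]
    gcongr
  have hc : -(1 / α) ≤ ∫ t in Ioi (1:ℝ),
      (|1 - t| ^ τ + (1 + t) ^ τ - 2) / t ^ (1 + 2 * α) := by
    have hval : ∫ t in Ioi (1:ℝ), (-2) * t ^ (-(1 + 2 * α)) = -(1 / α) := by
      rw [integral_const_mul, integral_Ioi_rpow_of_lt (by linarith) one_pos, one_rpow]
      have : -(1 + 2 * α) + 1 ≠ 0 := by linarith
      field_simp
      ring
    rw [← hval]
    refine setIntegral_mono_on
      ((integrableOn_Ioi_rpow_of_lt (by linarith) one_pos).const_mul (-2)) hfc measurableSet_Ioi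
      fun t ht => ?_
    have ht : 1 < t := ht
    have h3 : 0 ≤ |1 - t| ^ τ := by positivity
    have h4 : 0 ≤ (1 + t) ^ τ := rpow_nonneg (by linarith) _
    have hp : 0 < t ^ (1 + 2 * α) := rpow_pos_of_pos (by linarith) _
    rw [rpow_neg (by linarith), ← div_eq_mul_inv]
    gcongr
    linarith
  linarith

theorem c_tendsto_atTop (α : ℝ) (hα : α ∈ Set.Ioo (0:ℝ) 1) :
    Filter.Tendsto (fun τ => c α τ) (nhdsWithin (-1:ℝ) (Set.Ioi (-1:ℝ))) Filter.atTop := by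
  have hlim : Tendsto (fun τ : ℝ => τ + 1) (nhdsWithin (-1) (Ioi (-1))) (nhdsWithin 0 (Ioi 0)) := by
    refine tendsto_nhdsWithin_iff.2 ⟨?_, ?_⟩
    · exact (Continuous.tendsto' (by fun_prop) _ _ (by norm_num)).mono_left nhdsWithin_le_nhds
    · filter_upwards [self_mem_nhdsWithin] with τ hτ
      have hτ : -1 < τ := hτ
      exact mem_Ioi.2 (by linarith)
  have hbound : Tendsto (fun τ : ℝ => (1 / 2) * (τ + 1)⁻¹ - 1 - 1 / α)
      (nhdsWithin (-1) (Ioi (-1))) atTop := by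
    have h := (tendsto_inv_nhdsGT_zero.comp hlim).const_mul_atTop (by norm_num : (0:ℝ) < 1 / 2)
    simpa [sub_eq_add_neg, add_assoc] using tendsto_atTop_add_const_right _ (-1 - 1 / α) h
  refine tendsto_atTop_mono' _ ?_ hbound
  filter_upwards [Ioo_mem_nhdsGT (by norm_num : (-1:ℝ) < 0)] with τ hτ
  exact le_c hα hτ.1 hτ.2.le
end

section
/- For every α ∈ (0,1), the function t ↦ log|1−t²|/t^{1+2α} is Lebesgue integrable on the interval (0,∞). -/
open MeasureTheory Real Set

lemma integrableOn_Ioc_log_one_sub_sq_div_rpow {α : ℝ} (hα : α < 1) :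
    IntegrableOn (fun t : ℝ => log |1 - t ^ 2| / t ^ (1 + 2 * α)) (Ioc 0 (1 / 2)) := by
  have hbound : IntegrableOn (fun t : ℝ => 2 * t ^ (1 - 2 * α)) (Ioc 0 (1 / 2)) :=
    ((intervalIntegrable_iff_integrableOn_Ioc_of_le (by norm_num)).1
      (intervalIntegral.intervalIntegrable_rpow' (by linarith))).const_mul 2
  refine hbound.mono' (Measurable.aestronglyMeasurable (by fun_prop)) ?_
  filter_upwards [ae_restrict_mem measurableSet_Ioc] with t ⟨ht0, ht⟩
  have hsq : t ^ 2 ≤ 1 / 2 := by nlinarith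
  have hpos : 0 < 1 - t ^ 2 := by linarith
  have hlog_le : log (1 - t ^ 2) ≤ 0 := log_nonpos hpos.le (by nlinarith)
  have hlog : |log (1 - t ^ 2)| ≤ 2 * t ^ 2 := by
    rw [abs_of_nonpos hlog_le]
    have hinv : (1 - t ^ 2)⁻¹ ≤ 1 + 2 * t ^ 2 := by
      rw [inv_le_iff_one_le_mul₀ hpos]
      nlinarith [sq_nonneg t]
    linarith [one_sub_inv_le_log_of_pos hpos]
  have hrpow : t ^ (1 - 2 * α) = t ^ 2 / t ^ (1 + 2 * α) := by
    rw [← rpow_natCast t 2, ← rpow_sub ht0]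
    congr 1
    push_cast
    ring
  rw [log_abs, norm_eq_abs, abs_div, abs_of_pos (rpow_pos_of_pos ht0 _), hrpow, ← mul_div_assoc]
  gcongr

lemma integrableOn_Icc_log_one_sub_sq_div_rpow (β : ℝ) {a b : ℝ} (ha : 0 < a) (hab : a ≤ b) :
    IntegrableOn (fun t : ℝ => log |1 - t ^ 2| / t ^ β) (Icc a b) := by
  have hlog : IntegrableOn (fun t : ℝ => log |1 - t ^ 2|) (Icc a b) := by
    have hmero : MeromorphicOn (fun t : ℝ => 1 - t ^ 2) (uIcc a b) := fun t _ => by fun_prop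
    simpa only [log_abs, Function.comp_def] using
      (intervalIntegrable_iff_integrableOn_Icc_of_le hab).1 hmero.intervalIntegrable_log
  simp only [div_eq_mul_inv]
  refine hlog.mul_continuousOn (fun t ht => ?_) isCompact_Icc
  have ht0 : 0 < t := ha.trans_le ht.1
  exact ((continuousAt_rpow_const t β (Or.inl ht0.ne')).inv₀
    (rpow_pos_of_pos ht0 β).ne').continuousWithinAt

lemma integrableOn_Ioi_log_one_sub_sq_div_rpow {α : ℝ} (hα : 0 < α) :
    IntegrableOn (fun t : ℝ => log |1 - t ^ 2| / t ^ (1 + 2 * α)) (Ioi 2) := by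
  have hbound : IntegrableOn (fun t : ℝ => 2 / α * t ^ (-1 - α)) (Ioi 2) :=
    (integrableOn_Ioi_rpow_of_lt (by linarith) two_pos).const_mul _
  refine hbound.mono' (Measurable.aestronglyMeasurable (by fun_prop)) ?_
  filter_upwards [ae_restrict_mem measurableSet_Ioi] with t ht
  have ht2 : 2 < t := ht
  have ht0 : 0 < t := by linarith
  have hlog : log |1 - t ^ 2| ≤ 2 / α * t ^ α := by
    calc log |1 - t ^ 2| ≤ log (t ^ 2) := by
          apply log_le_log (abs_pos.2 (by nlinarith))
          rw [abs_le]
          constructor <;> nlinarith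
      _ = 2 * log t := by rw [log_pow]; norm_num
      _ ≤ 2 * (t ^ α / α) := by gcongr; exact log_le_rpow_div ht0.le hα
      _ = 2 / α * t ^ α := by ring
  have hlog_nonneg : 0 ≤ log |1 - t ^ 2| :=
    log_nonneg (le_abs.2 (Or.inr (by nlinarith)))
  have hrpow : t ^ (-1 - α) = t ^ α / t ^ (1 + 2 * α) := by
    rw [← rpow_sub ht0]
    congr 1
    ring
  rw [norm_eq_abs, abs_div, abs_of_pos (rpow_pos_of_pos ht0 _), abs_of_nonneg hlog_nonneg, hrpow,
    ← mul_div_assoc]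
  gcongr

theorem integrable_T_integrand (α : ℝ) (hα : α ∈ Set.Ioo (0:ℝ) 1) :
    MeasureTheory.IntegrableOn
      (fun t : ℝ => Real.log |1 - t ^ 2| / t ^ (1 + 2 * α)) (Set.Ioi (0:ℝ)) := by
  refine (((integrableOn_Ioc_log_one_sub_sq_div_rpow hα.2).union
    (integrableOn_Icc_log_one_sub_sq_div_rpow (1 + 2 * α) (a := 1 / 2) (b := 2)
      (by norm_num) (by norm_num))).union
    (integrableOn_Ioi_log_one_sub_sq_div_rpow hα.1)).mono_set fun t ht => ?_
  rcases le_or_gt t (1 / 2) with h | h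
  · exact Or.inl (Or.inl ⟨ht, h⟩)
  · rcases le_or_gt t 2 with h2 | h2
    · exact Or.inl (Or.inr ⟨h.le, h2⟩)
    · exact Or.inr h2
end

section
/- For every α ∈ (0,1), the function τ ↦ c(α,τ), restricted to the set (−1,0], has a derivative at the point τ = 0 (a one-sided derivative from within (−1,0]) equal to T(α). -/
open MeasureTheory Real Set

noncomputable def T (α : ℝ) : ℝ :=
  ∫ t in Set.Ioi (0:ℝ), Real.log |1 - t ^ 2| / t ^ (1 + 2 * α)

lemma abs_rpow_mul_log_le {a τ x : ℝ} (ha : 0 < a) (hτ : |τ| ≤ a / 2) (hx : 0 < x) :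
    |x ^ τ * log x| ≤ 2 / a * (x ^ a + x ^ (-a)) := by
  rw [abs_mul, abs_of_pos (rpow_pos_of_pos hx τ), rpow_def_of_pos hx, rpow_def_of_pos hx,
    rpow_def_of_pos hx]
  set l := log x
  have h1 : exp (l * τ) ≤ exp (a / 2 * |l|) := by
    apply exp_le_exp.2
    calc l * τ ≤ |l * τ| := le_abs_self _
      _ = |τ| * |l| := by rw [abs_mul, mul_comm]
      _ ≤ _ := by gcongr
  have h2 : |l| ≤ 2 / a * exp (a / 2 * |l|) := by
    have := add_one_le_exp (a / 2 * |l|)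
    rw [div_mul_eq_mul_div, le_div_iff₀ ha]
    linarith
  have h3 : exp (a * |l|) ≤ exp (l * a) + exp (l * -a) := by
    rcases abs_cases l with ⟨h, _⟩ | ⟨h, _⟩ <;> rw [h]
    · rw [mul_comm a]; linarith [exp_pos (l * -a)]
    · rw [show a * -l = l * -a by ring]; linarith [exp_pos (l * a)]
  calc exp (l * τ) * |l| ≤ exp (a / 2 * |l|) * (2 / a * exp (a / 2 * |l|)) := by gcongr
    _ = 2 / a * exp (a * |l|) := by
      rw [show a * |l| = a / 2 * |l| + a / 2 * |l| by ring, exp_add]; ring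
    _ ≤ _ := by gcongr

lemma abs_rpow_mul_log_sub_log_le {τ x : ℝ} (hx : 0 < x) (h : |τ| ≤ 1 / 2)
    (hl : |log x| ≤ 1) : |x ^ τ * log x - log x| ≤ log x ^ 2 := by
  have h1 : |log x * τ| ≤ |log x| / 2 := by
    rw [abs_mul, div_eq_mul_one_div]; gcongr
  have h2 := abs_exp_sub_one_le (x := log x * τ) (by linarith)
  rw [rpow_def_of_pos hx, show exp (log x * τ) * log x - log x = (exp (log x * τ) - 1) * log x by
    ring, abs_mul, ← sq_abs, sq]
  exact mul_le_mul_of_nonneg_right (by linarith) (abs_nonneg _)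

/-- Near `t = 0` the first-order terms cancel. -/
lemma abs_rpow_mul_log_add_le {τ t : ℝ} (hτ : |τ| ≤ 1 / 2) (h0 : 0 < t) (ht : t ≤ 1 / 2) :
    |(1 - t) ^ τ * log (1 - t) + (1 + t) ^ τ * log (1 + t)| ≤ 7 * t ^ 2 := by
  have key : ∀ s : ℝ, 0 ≤ s → s ≤ 1 / 2 → |log (1 - s)| ≤ 2 * s := fun s hs hs' => by
    have h1 := one_sub_inv_le_log_of_pos (show 0 < 1 - s by linarith)
    have h2 := log_nonpos (x := 1 - s) (by linarith) (by linarith)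
    rw [abs_of_nonpos h2]
    have : (1 - s)⁻¹ ≤ 1 + 2 * s := by
      rw [inv_le_iff_one_le_mul₀ (by linarith)]; nlinarith
    linarith
  have hm := key t h0.le ht
  have hq := key (t ^ 2) (by positivity) (by nlinarith)
  have hp : |log (1 + t)| ≤ t := by
    rw [abs_of_nonneg (log_nonneg (by linarith))]
    linarith [log_le_sub_one_of_pos (show 0 < 1 + t by linarith)]
  have hsum : log (1 - t ^ 2) = log (1 - t) + log (1 + t) := by
    rw [← log_mul (by linarith) (by linarith)]; ring_nf
  have e1 := abs_rpow_mul_log_sub_log_le (show 0 < 1 - t by linarith) hτ (by linarith)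
  have e2 := abs_rpow_mul_log_sub_log_le (show 0 < 1 + t by linarith) hτ (by linarith)
  have s1 : log (1 - t) ^ 2 ≤ (2 * t) ^ 2 := sq_le_sq' (by linarith [abs_le.1 hm]) (abs_le.1 hm).2
  have s2 : log (1 + t) ^ 2 ≤ t ^ 2 := sq_le_sq' (by linarith [abs_le.1 hp]) (abs_le.1 hp).2
  rw [hsum] at hq
  rw [abs_le] at *
  constructor <;> linarith

lemma abs_rpow_mul_log_add_div_le_mid {a τ t : ℝ} (ha : 0 < a) (ha1 : a < 1) (hτ : |τ| ≤ a / 2)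
    (h0 : 1 / 2 < t) (ht : t ≤ 2) (h1 : t ≠ 1) :
    |(|1 - t| ^ τ * log |1 - t| + (1 + t) ^ τ * log (1 + t)) / t ^ (1 + 2 * a)| ≤
      96 / a * |1 - t| ^ (-a) := by
  have hx : 0 < |1 - t| := abs_pos.2 (sub_ne_zero.2 h1.symm)
  have hx1 : |1 - t| ≤ 1 := abs_le.2 ⟨by linarith, by linarith⟩
  have b1 := abs_rpow_mul_log_le ha hτ hx
  have b2 := abs_rpow_mul_log_le ha hτ (show 0 < 1 + t by linarith)
  have b3 : |1 - t| ^ a ≤ 1 := rpow_le_one hx.le hx1 ha.le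
  have b4 : 1 ≤ |1 - t| ^ (-a) := one_le_rpow_of_pos_of_le_one_of_nonpos hx hx1 (by linarith)
  have b5 : (1 + t) ^ a ≤ 3 :=
    (rpow_le_rpow_of_exponent_le (by linarith) ha1.le).trans (by rw [rpow_one]; linarith)
  have b6 : (1 + t) ^ (-a) ≤ 1 := rpow_le_one_of_one_le_of_nonpos (by linarith) (by linarith)
  have b7 : (1 / 8 : ℝ) ≤ t ^ (1 + 2 * a) := by
    calc (1 / 8 : ℝ) = (1 / 2) ^ (3 : ℝ) := by norm_num
      _ ≤ (1 / 2) ^ (1 + 2 * a) :=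
        rpow_le_rpow_of_exponent_ge (by norm_num) (by norm_num) (by linarith)
      _ ≤ _ := rpow_le_rpow (by norm_num) h0.le (by linarith)
  rw [abs_div, abs_of_pos (show 0 < t ^ (1 + 2 * a) by linarith), div_le_iff₀ (by linarith)]
  calc _ ≤ 2 / a * (|1 - t| ^ a + |1 - t| ^ (-a)) + 2 / a * ((1 + t) ^ a + (1 + t) ^ (-a)) :=
        (abs_add_le _ _).trans (add_le_add b1 b2)
    _ = 2 / a * (|1 - t| ^ a + |1 - t| ^ (-a) + (1 + t) ^ a + (1 + t) ^ (-a)) := by ring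
    _ ≤ 2 / a * (6 * |1 - t| ^ (-a)) := by gcongr; linarith
    _ = 96 / a * |1 - t| ^ (-a) * (1 / 8) := by ring
    _ ≤ _ := by gcongr

lemma abs_rpow_mul_log_add_div_le_tail {a τ t : ℝ} (ha : 0 < a) (ha1 : a < 1) (hτ : |τ| ≤ a / 2)
    (ht : 2 < t) :
    |(|1 - t| ^ τ * log |1 - t| + (1 + t) ^ τ * log (1 + t)) / t ^ (1 + 2 * a)| ≤
      10 / a * t ^ (-1 - a) := by
  have hxe : |1 - t| = t - 1 := by rw [abs_of_neg (by linarith)]; ring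
  rw [hxe]
  have b1 := abs_rpow_mul_log_le ha hτ (show 0 < t - 1 by linarith)
  have b2 := abs_rpow_mul_log_le ha hτ (show 0 < 1 + t by linarith)
  have b3 : (t - 1) ^ a ≤ t ^ a := rpow_le_rpow (by linarith) (by linarith) ha.le
  have b4 : (t - 1) ^ (-a) ≤ 1 := rpow_le_one_of_one_le_of_nonpos (by linarith) (by linarith)
  have b5 : (1 + t) ^ a ≤ 2 * t ^ a := by
    calc (1 + t) ^ a ≤ (2 * t) ^ a := rpow_le_rpow (by linarith) (by linarith) ha.le
      _ = 2 ^ a * t ^ a := mul_rpow (by norm_num) (by linarith)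
      _ ≤ 2 ^ (1 : ℝ) * t ^ a := by gcongr; norm_num
      _ = _ := by rw [rpow_one]
  have b6 : (1 + t) ^ (-a) ≤ 1 := rpow_le_one_of_one_le_of_nonpos (by linarith) (by linarith)
  have b7 : 1 ≤ t ^ a := one_le_rpow (by linarith) ha.le
  have ht0 : 0 < t := by linarith
  have b8 : t ^ (-1 - a) * t ^ (1 + 2 * a) = t ^ a := by rw [← rpow_add ht0]; ring_nf
  rw [abs_div, abs_of_pos (rpow_pos_of_pos ht0 (1 + 2 * a)),
    div_le_iff₀ (rpow_pos_of_pos ht0 _), mul_assoc, b8]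
  calc _ ≤ 2 / a * ((t - 1) ^ a + (t - 1) ^ (-a)) + 2 / a * ((1 + t) ^ a + (1 + t) ^ (-a)) :=
        (abs_add_le _ _).trans (add_le_add b1 b2)
    _ = 2 / a * ((t - 1) ^ a + (t - 1) ^ (-a) + (1 + t) ^ a + (1 + t) ^ (-a)) := by ring
    _ ≤ 2 / a * (5 * t ^ a) := by gcongr; linarith
    _ = _ := by ring

lemma integrableOn_abs_one_sub_rpow {r : ℝ} (hr : -1 < r) :
    IntegrableOn (fun t : ℝ => |1 - t| ^ r) (Ioc (1 / 2) 2) := by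
  have h1 : IntervalIntegrable (fun x : ℝ => |x| ^ r) volume (-1) (1 / 2) := by
    apply IntervalIntegrable.trans (b := 0)
    · have := (intervalIntegral.intervalIntegrable_rpow' (a := 0) (b := 1) hr).comp_sub_left 0
      simp only [zero_sub, sub_zero] at this
      refine this.symm.congr fun x hx => ?_
      rw [uIoc_of_le (by norm_num)] at hx
      simp only [abs_of_nonpos hx.2]
    · refine (intervalIntegral.intervalIntegrable_rpow' hr).congr fun x hx => ?_
      rw [uIoc_of_le (by norm_num)] at hx
      simp only [abs_of_pos hx.1]
  have h2 := (h1.comp_sub_left 1).symm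
  rw [intervalIntegrable_iff_integrableOn_Ioc_of_le (by norm_num)] at h2
  norm_num at h2 ⊢
  exact h2

lemma abs_rpow_mul_log_add_div_le_head {a τ t : ℝ} (ha1 : a < 1) (hτ : |τ| ≤ a / 2)
    (h0 : 0 < t) (ht : t ≤ 1 / 2) :
    |(|1 - t| ^ τ * log |1 - t| + (1 + t) ^ τ * log (1 + t)) / t ^ (1 + 2 * a)| ≤
      7 * t ^ (1 - 2 * a) := by
  have h := abs_rpow_mul_log_add_le (τ := τ) (by linarith) h0 ht
  have e : t ^ (1 - 2 * a) * t ^ (1 + 2 * a) = t ^ 2 := by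
    rw [← rpow_add h0, ← rpow_natCast]; norm_num
  rwa [abs_of_pos (show 0 < 1 - t by linarith), abs_div, abs_of_pos (rpow_pos_of_pos h0 _),
    div_le_iff₀ (rpow_pos_of_pos h0 _), mul_assoc, e]

/-- A dominating function for the derivatives of the integrand, uniformly in the exponent. -/
lemma exists_integrableOn_bound {a : ℝ} (ha : 0 < a) (ha1 : a < 1) :
    ∃ b : ℝ → ℝ, IntegrableOn b (Ioi 0) ∧ ∀ t, 0 < t → t ≠ 1 → ∀ τ, |τ| ≤ a / 2 →
      |(|1 - t| ^ τ * log |1 - t| + (1 + t) ^ τ * log (1 + t)) / t ^ (1 + 2 * a)| ≤ b t := by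
  refine ⟨fun t => (Ioc 0 (1 / 2)).indicator (fun t => 7 * t ^ (1 - 2 * a)) t +
    (Ioc (1 / 2) 2).indicator (fun t => 96 / a * |1 - t| ^ (-a)) t +
    (Ioi 2).indicator (fun t => 10 / a * t ^ (-1 - a)) t, ?_, ?_⟩
  · refine Integrable.integrableOn (.add (.add ?_ ?_) ?_)
    · rw [integrable_indicator_iff measurableSet_Ioc,
        ← intervalIntegrable_iff_integrableOn_Ioc_of_le (by norm_num)]
      exact (intervalIntegral.intervalIntegrable_rpow' (by linarith)).const_mul _
    · rw [integrable_indicator_iff measurableSet_Ioc]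
      exact (integrableOn_abs_one_sub_rpow (by linarith)).const_mul _
    · rw [integrable_indicator_iff measurableSet_Ioi]
      exact (integrableOn_Ioi_rpow_of_lt (by linarith) (by norm_num)).const_mul _
  · intro t h0 h1 τ hτ
    rcases le_or_gt t (1 / 2) with h | h
    · have m1 : t ∈ Ioc (0 : ℝ) (1 / 2) := ⟨h0, h⟩
      have m2 : t ∉ Ioc (1 / 2 : ℝ) 2 := fun ht => h.not_gt ht.1
      have m3 : t ∉ Ioi (2 : ℝ) := fun ht => by linarith [mem_Ioi.1 ht]
      simpa only [indicator_of_mem m1, indicator_of_notMem m2, indicator_of_notMem m3, add_zero]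
        using abs_rpow_mul_log_add_div_le_head ha1 hτ h0 h
    have m1 : t ∉ Ioc (0 : ℝ) (1 / 2) := fun ht => h.not_ge ht.2
    rcases le_or_gt t 2 with h2 | h2
    · have m2 : t ∈ Ioc (1 / 2 : ℝ) 2 := ⟨h, h2⟩
      have m3 : t ∉ Ioi (2 : ℝ) := h2.not_gt
      simpa only [indicator_of_notMem m1, indicator_of_mem m2, indicator_of_notMem m3, add_zero,
        zero_add] using abs_rpow_mul_log_add_div_le_mid ha ha1 hτ h h2 h1
    · have m2 : t ∉ Ioc (1 / 2 : ℝ) 2 := fun ht => h2.not_ge ht.2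
      have m3 : t ∈ Ioi (2 : ℝ) := h2
      simpa only [indicator_of_notMem m1, indicator_of_notMem m2, indicator_of_mem m3, zero_add]
        using abs_rpow_mul_log_add_div_le_tail ha ha1 hτ h2

theorem hasDerivWithinAt_c_zero (α : ℝ) (hα : α ∈ Set.Ioo (0:ℝ) 1) :
    HasDerivWithinAt (fun τ => c α τ) (T α) (Set.Ioc (-1:ℝ) 0) 0 := by
  obtain ⟨h0, h1⟩ := hα
  obtain ⟨b, hb, hbound⟩ := exists_integrableOn_bound h0 h1
  have hne : ∀ᵐ t ∂volume.restrict (Ioi (0 : ℝ)), 0 < t ∧ t ≠ 1 :=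
    (ae_restrict_mem measurableSet_Ioi).and (ae_restrict_of_ae (Measure.ae_ne volume 1))
  have key := hasDerivAt_integral_of_dominated_loc_of_deriv_le
    (μ := volume.restrict (Ioi (0 : ℝ))) (x₀ := (0 : ℝ))
    (F := fun τ t => (|1 - t| ^ τ + (1 + t) ^ τ - 2) / t ^ (1 + 2 * α))
    (F' := fun τ t =>
      (|1 - t| ^ τ * log |1 - t| + (1 + t) ^ τ * log (1 + t)) / t ^ (1 + 2 * α))
    (Metric.closedBall_mem_nhds (0 : ℝ) (half_pos h0))
    (.of_forall fun τ => by
      apply Measurable.aestronglyMeasurable; fun_prop)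
    (by norm_num)
    (by apply Measurable.aestronglyMeasurable; fun_prop)
    (hne.mono fun t ht τ hτ => hbound t ht.1 ht.2 τ (by simpa using hτ)) hb
    (hne.mono fun t ht τ _ => by
      have d1 := (hasStrictDerivAt_const_rpow
        (abs_pos.2 (sub_ne_zero.2 ht.2.symm) : 0 < |1 - t|) τ).hasDerivAt
      have d2 := (hasStrictDerivAt_const_rpow (show 0 < 1 + t by linarith [ht.1]) τ).hasDerivAt
      exact ((d1.add d2).sub_const 2).div_const (t ^ (1 + 2 * α)))
  refine key.2.hasDerivWithinAt.congr_deriv (integral_congr_ae (hne.mono fun t ht => ?_))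
  have h2 : |1 - t ^ 2| = |1 - t| * (1 + t) := by
    rw [show 1 - t ^ 2 = (1 - t) * (1 + t) by ring, abs_mul,
      abs_of_pos (show 0 < 1 + t by linarith [ht.1])]
  simp only [rpow_zero, one_mul, h2]
  rw [log_mul (abs_pos.2 (sub_ne_zero.2 ht.2.symm)).ne' (by linarith [ht.1])]
end

section
/- T(α) tends to −∞ as α tends to 1 from the left, i.e. lim_{α→1⁻} T(α) = −∞. -/
open MeasureTheory Real Set Filter

theorem neg_log_le_two_mul_rpow_neg_half {x : ℝ} (hx : 0 < x) :
    -log x ≤ 2 * (x ^ (-(1 / 2) : ℝ) - 1) := by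
  have h := log_le_sub_one_of_pos (rpow_pos_of_pos hx (-(1 / 2)))
  rw [log_rpow hx] at h
  linarith

theorem neg_log_le_two_mul_one_sub_mul_rpow {x : ℝ} (hx : 0 < x) (hx1 : x ≤ 1) :
    -log x ≤ 2 * ((1 - x) * x ^ (-(1 / 2) : ℝ)) := by
  have h := neg_log_le_two_mul_rpow_neg_half hx
  have h2 : x * x ^ (-(1 / 2) : ℝ) ≤ 1 := by
    calc x * x ^ (-(1 / 2) : ℝ) = x ^ (1 / 2 : ℝ) := by
          nth_rewrite 1 [← rpow_one x]
          rw [← rpow_add hx]; norm_num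
      _ ≤ 1 := rpow_le_one hx.le hx1 (by norm_num)
  linarith

theorem measurable_log_abs_one_sub_sq_div_rpow (α : ℝ) :
    Measurable fun t : ℝ => log |1 - t ^ 2| / t ^ (1 + 2 * α) := by
  have : Measurable fun t : ℝ => log |1 - t ^ 2| :=
    measurable_log.comp (continuous_abs.measurable.comp (by fun_prop))
  exact this.div (measurable_id.pow_const _)

theorem integrableOn_rpow_mul_one_sub_rpow {u v : ℝ} (hu : 0 < u) (hv : 0 < v) :
    IntegrableOn (fun t : ℝ => t ^ (u - 1) * (1 - t) ^ (v - 1)) (Ioo 0 1) := by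
  have h := (intervalIntegrable_iff_integrableOn_Ioo_of_le zero_le_one).1
    (Complex.betaIntegral_convergent (u := u) (v := v) (by simpa) (by simpa))
  refine IntegrableOn.congr_fun (Integrable.norm h) (fun t ht => ?_) measurableSet_Ioo
  have h1 : 0 < 1 - t := sub_pos.2 ht.2
  have e : (1 - (t : ℂ)) = ((1 - t : ℝ) : ℂ) := by push_cast; rfl
  simp only [norm_mul, e]
  rw [Complex.norm_cpow_eq_rpow_re_of_pos ht.1, Complex.norm_cpow_eq_rpow_re_of_pos h1]
  simp

theorem integrableOn_Ioo_log_abs_one_sub_sq_div_rpow {α : ℝ} (hα : α < 1) :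
    IntegrableOn (fun t : ℝ => log |1 - t ^ 2| / t ^ (1 + 2 * α)) (Ioo 0 1) := by
  have hb := (integrableOn_rpow_mul_one_sub_rpow (u := 2 - 2 * α) (v := 1 / 2)
    (by linarith) (by norm_num)).const_mul 2
  refine hb.mono' (measurable_log_abs_one_sub_sq_div_rpow α).aestronglyMeasurable ?_
  refine (ae_restrict_iff' measurableSet_Ioo).2 (Eventually.of_forall fun t ht => ?_)
  obtain ⟨h0, h1⟩ := ht
  have hx : 0 < 1 - t ^ 2 := by nlinarith
  have hx1 : 1 - t ^ 2 ≤ 1 := by nlinarith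
  have hp : 0 < t ^ (1 + 2 * α) := rpow_pos_of_pos h0 _
  rw [abs_of_pos hx, norm_div, norm_of_nonneg hp.le, Real.norm_eq_abs,
    abs_of_nonpos (log_nonpos hx.le hx1), div_le_iff₀ hp]
  have e : t ^ (2 - 2 * α - 1) * t ^ (1 + 2 * α) = t ^ 2 := by
    rw [← rpow_add h0, ← rpow_natCast]; congr 1; push_cast; ring
  have hr : (1 - t ^ 2) ^ (-(1 / 2) : ℝ) ≤ (1 - t) ^ (-(1 / 2) : ℝ) :=
    rpow_le_rpow_of_nonpos (by linarith) (by nlinarith) (by norm_num)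
  calc -log (1 - t ^ 2) ≤ 2 * ((1 - (1 - t ^ 2)) * (1 - t ^ 2) ^ (-(1 / 2) : ℝ)) :=
        neg_log_le_two_mul_one_sub_mul_rpow hx hx1
    _ ≤ 2 * (t ^ 2 * (1 - t) ^ (-(1 / 2) : ℝ)) := by
        rw [sub_sub_cancel]; gcongr
    _ = 2 * (t ^ (2 - 2 * α - 1) * (1 - t) ^ (1 / 2 - 1 : ℝ)) * t ^ (1 + 2 * α) := by
        rw [← e]; norm_num; ring

theorem log_abs_one_sub_sq_le {t : ℝ} (ht : 1 < t) : log |1 - t ^ 2| ≤ 2 * t := by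
  have hx : 0 < t ^ 2 - 1 := by nlinarith
  rw [abs_sub_comm, abs_of_pos hx]
  calc log (t ^ 2 - 1) ≤ log (t ^ 2) := log_le_log hx (by linarith)
    _ = 2 * log t := by rw [log_pow]; norm_num
    _ ≤ 2 * t := by linarith [log_le_self (zero_le_one.trans ht.le)]

theorem two_mul_div_rpow_le {α t : ℝ} (hα : 3 / 4 ≤ α) (ht : 1 < t) :
    2 * t / t ^ (1 + 2 * α) ≤ 2 * t ^ (-(3 / 2) : ℝ) := by
  have h0 : 0 < t := one_pos.trans ht
  rw [div_le_iff₀ (rpow_pos_of_pos h0 _), mul_assoc, ← rpow_add h0]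
  gcongr
  exact self_le_rpow_of_one_le ht.le (by linarith)

theorem integrableOn_Ioi_one_two_mul_rpow :
    IntegrableOn (fun t : ℝ => 2 * t ^ (-(3 / 2) : ℝ)) (Ioi 1) :=
  (integrableOn_Ioi_rpow_of_lt (by norm_num) one_pos).const_mul 2

theorem integrableOn_Ioi_log_abs_one_sub_sq_div_rpow {α : ℝ} (hα : 3 / 4 ≤ α) :
    IntegrableOn (fun t : ℝ => log |1 - t ^ 2| / t ^ (1 + 2 * α)) (Ioi 1) := by
  have hm := (measurable_log_abs_one_sub_sq_div_rpow α).aestronglyMeasurable (μ := volume)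
  rw [← Ioc_union_Ioi_eq_Ioi one_le_two]
  refine IntegrableOn.union ?_ ?_
  · have hs : IntegrableOn (fun t : ℝ => (t - 1) ^ (-(1 / 2) : ℝ)) (Ioc 1 2) := by
      have h := (intervalIntegral.intervalIntegrable_rpow' (a := 0) (b := 1)
        (r := -(1 / 2)) (by norm_num)).comp_sub_right 1
      norm_num at h
      exact (intervalIntegrable_iff_integrableOn_Ioc_of_le one_le_two).1 (by norm_num; exact h)
    have hc : IntegrableOn (fun _ : ℝ => (4 : ℝ)) (Ioc 1 2) := by simp
    refine (hc.add (hs.const_mul 2)).mono' hm.restrict ?_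
    refine (ae_restrict_iff' measurableSet_Ioc).2 (Eventually.of_forall fun t ht => ?_)
    obtain ⟨h1, h2⟩ := ht
    have hp : 1 ≤ t ^ (1 + 2 * α) := one_le_rpow h1.le (by linarith)
    have hx : 0 < t ^ 2 - 1 := by nlinarith
    rw [norm_div, norm_of_nonneg (zero_le_one.trans hp), Real.norm_eq_abs]
    refine (div_le_self (abs_nonneg _) hp).trans ?_
    have hu := log_abs_one_sub_sq_le h1
    have hr : (t ^ 2 - 1) ^ (-(1 / 2) : ℝ) ≤ (t - 1) ^ (-(1 / 2) : ℝ) :=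
      rpow_le_rpow_of_nonpos (by linarith) (by nlinarith) (by norm_num)
    have hl := neg_log_le_two_mul_rpow_neg_half hx
    have hq : 0 < (t - 1) ^ (-(1 / 2) : ℝ) := rpow_pos_of_pos (by linarith) _
    rw [abs_sub_comm, abs_of_pos hx] at hu ⊢
    simp only [Pi.add_apply]
    rw [abs_le]
    constructor <;> linarith
  · refine (integrableOn_Ioi_one_two_mul_rpow.mono_set (Ioi_subset_Ioi one_le_two)).mono'
      hm.restrict ?_
    refine (ae_restrict_iff' measurableSet_Ioi).2 (Eventually.of_forall fun t ht => ?_)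
    have h2 : 2 < t := ht
    have h1 : 1 < t := by linarith
    have hp : 0 < t ^ (1 + 2 * α) := rpow_pos_of_pos (by linarith) _
    have hn : 0 ≤ log |1 - t ^ 2| := by
      rw [abs_sub_comm, abs_of_pos (by nlinarith)]
      exact log_nonneg (by nlinarith)
    rw [norm_of_nonneg (div_nonneg hn hp.le)]
    exact (div_le_div_of_nonneg_right (log_abs_one_sub_sq_le h1) hp.le).trans
      (two_mul_div_rpow_le hα h1)

theorem setIntegral_Ioi_log_abs_one_sub_sq_div_rpow_le {α : ℝ} (hα : 3 / 4 ≤ α) :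
    ∫ t in Ioi (1 : ℝ), log |1 - t ^ 2| / t ^ (1 + 2 * α) ≤ 4 := by
  calc _ ≤ ∫ t in Ioi (1 : ℝ), 2 * t ^ (-(3 / 2) : ℝ) :=
        setIntegral_mono_on (integrableOn_Ioi_log_abs_one_sub_sq_div_rpow hα)
          integrableOn_Ioi_one_two_mul_rpow measurableSet_Ioi fun t ht =>
            (div_le_div_of_nonneg_right (log_abs_one_sub_sq_le ht)
              (rpow_nonneg (zero_le_one.trans (le_of_lt ht)) _)).trans (two_mul_div_rpow_le hα ht)
    _ = 4 := by
        rw [integral_const_mul, integral_Ioi_rpow_of_lt (by norm_num) one_pos]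
        norm_num

theorem setIntegral_Ioo_log_abs_one_sub_sq_div_rpow_le {α : ℝ} (hα : α < 1) :
    ∫ t in Ioo (0 : ℝ) 1, log |1 - t ^ 2| / t ^ (1 + 2 * α) ≤ -(2 - 2 * α)⁻¹ := by
  have hi : IntervalIntegrable (fun t : ℝ => t ^ (1 - 2 * α)) volume 0 1 :=
    intervalIntegral.intervalIntegrable_rpow' (by linarith)
  calc _ ≤ ∫ t in Ioo (0 : ℝ) 1, -t ^ (1 - 2 * α) := by
        refine setIntegral_mono_on (integrableOn_Ioo_log_abs_one_sub_sq_div_rpow hα)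
          ((intervalIntegrable_iff_integrableOn_Ioo_of_le zero_le_one).1 hi).neg
          measurableSet_Ioo fun t ht => ?_
        obtain ⟨h0, h1⟩ := ht
        have hx : 0 < 1 - t ^ 2 := by nlinarith
        have e : t ^ (1 - 2 * α) * t ^ (1 + 2 * α) = t ^ 2 := by
          rw [← rpow_add h0, ← rpow_natCast]; congr 1; push_cast; ring
        rw [abs_of_pos hx, div_le_iff₀ (rpow_pos_of_pos h0 _), neg_mul, e]
        linarith [log_le_sub_one_of_pos hx]
    _ = -(2 - 2 * α)⁻¹ := by
        rw [integral_neg, ← integral_Ioc_eq_integral_Ioo,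
          ← intervalIntegral.integral_of_le zero_le_one, integral_rpow (Or.inl (by linarith)),
          one_rpow, zero_rpow (by linarith), sub_zero, one_div]
        congr 2; ring

theorem T_le {α : ℝ} (hα : 3 / 4 ≤ α) (hα1 : α < 1) : T α ≤ -(2 - 2 * α)⁻¹ + 4 := by
  have hi := integrableOn_Ioo_log_abs_one_sub_sq_div_rpow hα1
  rw [T, ← Ioc_union_Ioi_eq_Ioi zero_le_one,
    setIntegral_union (Ioc_disjoint_Ioi le_rfl) measurableSet_Ioi
      ((integrableOn_Ioc_iff_integrableOn_Ioo (by simp)).2 hi)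
      (integrableOn_Ioi_log_abs_one_sub_sq_div_rpow hα), integral_Ioc_eq_integral_Ioo]
  exact add_le_add (setIntegral_Ioo_log_abs_one_sub_sq_div_rpow_le hα1)
    (setIntegral_Ioi_log_abs_one_sub_sq_div_rpow_le hα)

theorem T_tendsto_atBot :
    Filter.Tendsto T (nhdsWithin (1:ℝ) (Set.Iio (1:ℝ))) Filter.atBot := by
  have h0 : Tendsto (fun α : ℝ => 2 - 2 * α) (nhdsWithin 1 (Iio 1)) (nhdsWithin 0 (Ioi 0)) := by
    refine tendsto_nhdsWithin_iff.2 ⟨?_, ?_⟩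
    · refine Tendsto.mono_left ?_ nhdsWithin_le_nhds
      have : Continuous fun α : ℝ => 2 - 2 * α := by fun_prop
      simpa using this.tendsto 1
    · filter_upwards [self_mem_nhdsWithin] with α hα
      have : α < 1 := hα
      exact mem_Ioi.2 (by linarith)
  have h1 : Tendsto (fun α : ℝ => -(2 - 2 * α)⁻¹ + 4) (nhdsWithin 1 (Iio 1)) atBot :=
    tendsto_atBot_add_const_right _ _
      (tendsto_neg_atTop_atBot.comp (tendsto_inv_nhdsGT_zero.comp h0))
  refine tendsto_atBot_mono' _ ?_ h1
  filter_upwards [self_mem_nhdsWithin,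
    mem_nhdsWithin_of_mem_nhds (Ici_mem_nhds (by norm_num : (3 / 4 : ℝ) < 1))] with α hα hα'
  exact T_le hα' hα
end

section
/- T(α) tends to +∞ as α tends to 0 from the right, i.e. lim_{α→0⁺} T(α) = +∞. -/
open MeasureTheory Real Set Filter

lemma intervalIntegrable_log_abs_one_sub_sq (a b : ℝ) :
    IntervalIntegrable (fun t : ℝ => Real.log |1 - t ^ 2|) volume a b := by
  have h : MeromorphicOn (fun t : ℝ => 1 - t ^ 2) (Set.uIcc a b) := fun x _ => by fun_prop
  simpa only [Real.norm_eq_abs] using h.intervalIntegrable_log_norm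

lemma measurable_log_div_rpow (α : ℝ) :
    Measurable fun t : ℝ => Real.log |1 - t ^ 2| / t ^ (1 + 2 * α) := by
  simp only [Real.log_abs]
  fun_prop

/-- A bound near the origin and the singularity at `1` that is uniform in `α ≤ 1 / 2`. -/
lemma abs_log_div_rpow_le {α t : ℝ} (hα : 0 < α) (hα' : α ≤ 1 / 2) (ht : 0 < t) :
    |Real.log |1 - t ^ 2| / t ^ (1 + 2 * α)| ≤ 2 + 4 * |Real.log (|1 - t ^ 2|)| := by
  have hp : 0 < t ^ (1 + 2 * α) := Real.rpow_pos_of_pos ht _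
  rw [abs_div, abs_of_pos hp, div_le_iff₀ hp]
  rcases le_total t (1 / 2) with h | h
  · have hpow : t ^ 2 ≤ t ^ (1 + 2 * α) := by
      rw [← Real.rpow_two]
      exact Real.rpow_le_rpow_of_exponent_ge ht (by linarith) (by linarith)
    have hsq : t ^ 2 ≤ 1 / 4 := by nlinarith
    have hpos : 0 < 1 - t ^ 2 := by linarith
    have hlog : |Real.log (|1 - t ^ 2|)| ≤ 2 * t ^ 2 := by
      rw [abs_of_pos hpos, abs_le]
      constructor
      · refine le_trans ?_ (Real.one_sub_inv_le_log_of_pos hpos)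
        have : (1 - t ^ 2)⁻¹ ≤ 1 + 2 * t ^ 2 := by
          rw [inv_le_iff_one_le_mul₀ hpos]
          nlinarith [sq_nonneg t]
        linarith
      · exact (Real.log_nonpos hpos.le (by nlinarith)).trans (by positivity)
    nlinarith [mul_nonneg (abs_nonneg (Real.log |1 - t ^ 2|)) hp.le]
  · have hpow : 1 / 4 ≤ t ^ (1 + 2 * α) := by
      calc (1 / 4 : ℝ) = (1 / 2) ^ (2 : ℝ) := by norm_num
        _ ≤ (1 / 2) ^ (1 + 2 * α) :=
          Real.rpow_le_rpow_of_exponent_ge (by norm_num) (by norm_num) (by linarith)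
        _ ≤ t ^ (1 + 2 * α) := Real.rpow_le_rpow (by norm_num) h (by linarith)
    nlinarith [mul_le_mul_of_nonneg_left hpow (abs_nonneg (Real.log |1 - t ^ 2|))]

lemma integrableOn_two_add_abs_log :
    IntegrableOn (fun t : ℝ => 2 + 4 * |Real.log (|1 - t ^ 2|)|) (Set.Ioc 0 2) := by
  rw [← intervalIntegrable_iff_integrableOn_Ioc_of_le zero_le_two]
  exact intervalIntegrable_const.add ((intervalIntegrable_log_abs_one_sub_sq 0 2).abs.const_mul 4)

lemma integrableOn_Ioc_log_div_rpow {α : ℝ} (hα : 0 < α) (hα' : α ≤ 1 / 2) :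
    IntegrableOn (fun t : ℝ => Real.log |1 - t ^ 2| / t ^ (1 + 2 * α)) (Set.Ioc 0 2) := by
  refine integrableOn_two_add_abs_log.mono' (measurable_log_div_rpow α).aestronglyMeasurable ?_
  filter_upwards [ae_restrict_mem measurableSet_Ioc] with t ht
  exact abs_log_div_rpow_le hα hα' ht.1

lemma one_le_log_abs_one_sub_sq {t : ℝ} (ht : 2 < t) : 1 ≤ Real.log |1 - t ^ 2| := by
  have h : 3 ≤ t ^ 2 - 1 := by nlinarith
  rw [abs_sub_comm, abs_of_pos (by linarith), Real.le_log_iff_exp_le (by linarith)]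
  linarith [Real.exp_one_lt_d9]

lemma integrableOn_Ioi_log_div_rpow {α : ℝ} (hα : 0 < α) :
    IntegrableOn (fun t : ℝ => Real.log |1 - t ^ 2| / t ^ (1 + 2 * α)) (Set.Ioi 2) := by
  refine ((integrableOn_Ioi_rpow_of_lt (a := -1 - α) (by linarith) zero_lt_two).const_mul
    (2 / α)).mono' (measurable_log_div_rpow α).aestronglyMeasurable ?_
  filter_upwards [ae_restrict_mem measurableSet_Ioi] with t (ht : 2 < t)
  have ht0 : 0 < t := by linarith
  have hp : 0 < t ^ (1 + 2 * α) := Real.rpow_pos_of_pos ht0 _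
  have hlog : Real.log |1 - t ^ 2| ≤ 2 / α * t ^ α := by
    have h1 : 0 < t ^ 2 - 1 := by nlinarith
    calc Real.log |1 - t ^ 2| = Real.log (t ^ 2 - 1) := by rw [abs_sub_comm, abs_of_pos h1]
      _ ≤ Real.log (t ^ 2) := Real.log_le_log h1 (by linarith)
      _ = 2 * Real.log t := by simp
      _ ≤ 2 * (t ^ α / α) := by gcongr; exact Real.log_le_rpow_div ht0.le hα
      _ = 2 / α * t ^ α := by ring
  rw [Real.norm_eq_abs, abs_of_nonneg
    (div_nonneg (zero_le_one.trans (one_le_log_abs_one_sub_sq ht)) hp.le), div_le_iff₀ hp,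
    mul_assoc, ← Real.rpow_add ht0, show -1 - α + (1 + 2 * α) = α by ring]
  exact hlog

lemma le_setIntegral_Ioi_log_div_rpow {α : ℝ} (hα : 0 < α) :
    2 ^ (-(2 * α)) / (2 * α) ≤
      ∫ t in Set.Ioi (2 : ℝ), Real.log |1 - t ^ 2| / t ^ (1 + 2 * α) := by
  have hlt : -(1 + 2 * α) < -1 := by linarith
  have hval : (2 : ℝ) ^ (-(2 * α)) / (2 * α) = ∫ t in Set.Ioi (2 : ℝ), t ^ (-(1 + 2 * α)) := by
    rw [integral_Ioi_rpow_of_lt hlt zero_lt_two,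
      show -(1 + 2 * α) + 1 = -(2 * α) by ring, neg_div_neg_eq]
  rw [hval]
  refine setIntegral_mono_on (integrableOn_Ioi_rpow_of_lt hlt zero_lt_two)
    (integrableOn_Ioi_log_div_rpow hα) measurableSet_Ioi fun t (ht : 2 < t) => ?_
  have ht0 : 0 < t := by linarith
  rw [Real.rpow_neg ht0.le, ← one_div]
  gcongr
  exact one_le_log_abs_one_sub_sq ht

lemma le_T {α : ℝ} (hα : 0 < α) (hα' : α ≤ 1 / 2) :
    -(∫ t in Set.Ioc (0 : ℝ) 2, (2 + 4 * |Real.log (|1 - t ^ 2|)|)) + 1 / 4 * α⁻¹ ≤ T α := by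
  have hsplit : T α = (∫ t in Set.Ioc (0 : ℝ) 2, Real.log |1 - t ^ 2| / t ^ (1 + 2 * α)) +
      ∫ t in Set.Ioi (2 : ℝ), Real.log |1 - t ^ 2| / t ^ (1 + 2 * α) := by
    rw [T, ← Set.Ioc_union_Ioi_eq_Ioi zero_le_two]
    exact setIntegral_union (Set.Ioc_disjoint_Ioi le_rfl) measurableSet_Ioi
      (integrableOn_Ioc_log_div_rpow hα hα') (integrableOn_Ioi_log_div_rpow hα)
  rw [hsplit]
  refine add_le_add ?_ (le_trans ?_ (le_setIntegral_Ioi_log_div_rpow hα))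
  · rw [← integral_neg]
    exact setIntegral_mono_on integrableOn_two_add_abs_log.neg
      (integrableOn_Ioc_log_div_rpow hα hα') measurableSet_Ioc
      fun t ht => (abs_le.mp (abs_log_div_rpow_le hα hα' ht.1)).1
  · have h : (1 / 2 : ℝ) ≤ 2 ^ (-(2 * α)) := by
      calc (1 / 2 : ℝ) = 2 ^ (-1 : ℝ) := by rw [Real.rpow_neg_one]; norm_num
        _ ≤ 2 ^ (-(2 * α)) := Real.rpow_le_rpow_of_exponent_le one_le_two (by linarith)
    calc 1 / 4 * α⁻¹ = 1 / 2 / (2 * α) := by field_simp; norm_num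
      _ ≤ 2 ^ (-(2 * α)) / (2 * α) := by gcongr

theorem T_tendsto_atTop :
    Filter.Tendsto T (nhdsWithin (0:ℝ) (Set.Ioi (0:ℝ))) Filter.atTop := by
  refine tendsto_atTop_mono' _ ?_ (tendsto_atTop_add_const_left _
    (-(∫ t in Set.Ioc (0 : ℝ) 2, (2 + 4 * |Real.log (|1 - t ^ 2|)|)))
    (tendsto_inv_nhdsGT_zero.const_mul_atTop (show (0 : ℝ) < 1 / 4 by norm_num)))
  filter_upwards [Ioc_mem_nhdsGT (show (0 : ℝ) < 1 / 2 by norm_num)] with α hα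
  exact le_T hα.1 hα.2
end

section
/- For every α ∈ (0,1), the function t ↦ (log|1−t²|) · (log t)/t^{1+2α} is Lebesgue integrable on (0,∞) and its integral is strictly positive: ∫₀^∞ (log|1−t²|)(log t)/t^{1+2α} dt > 0. -/
open MeasureTheory Real Set

theorem neg_log_le_rpow_sub_one_div {t ε : ℝ} (ht : 0 < t) (hε : 0 < ε) :
    -log t ≤ (t ^ (-ε) - 1) / ε := by
  have h := log_le_sub_one_of_pos (rpow_pos_of_pos ht (-ε))
  rw [log_rpow ht] at h
  rw [le_div_iff₀ hε]
  linarith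

theorem log_one_sub_sq_mul_log_le {t ε : ℝ} (ht : 0 < t) (ht1 : t < 1) (hε : 0 < ε)
    (hε1 : ε ≤ 1) : log (1 - t ^ 2) * log t ≤ t ^ (2 - ε) / ε := by
  have hu : 0 < 1 - t ^ 2 := by nlinarith
  have hM : -log (1 - t ^ 2) ≤ t ^ 2 / (1 - t ^ 2) := by
    have h := one_sub_inv_le_log_of_pos hu
    have h' : t ^ 2 / (1 - t ^ 2) = (1 - t ^ 2)⁻¹ - 1 := by field_simp; ring
    linarith
  have hpow : t ^ 2 ≤ t ^ ε := by
    rw [← rpow_natCast]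
    exact rpow_le_rpow_of_exponent_ge ht ht1.le (by norm_num; linarith)
  have hL : -log t ≤ t ^ (-ε) * (1 - t ^ 2) / ε := by
    refine (neg_log_le_rpow_sub_one_div ht hε).trans ?_
    have h : t ^ (-ε) * t ^ ε = 1 := by rw [← rpow_add ht]; simp
    gcongr
    nlinarith [mul_le_mul_of_nonneg_left hpow (rpow_nonneg ht.le (-ε))]
  calc log (1 - t ^ 2) * log t = -log (1 - t ^ 2) * -log t := by ring
    _ ≤ t ^ 2 / (1 - t ^ 2) * (t ^ (-ε) * (1 - t ^ 2) / ε) :=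
        mul_le_mul hM hL (by linarith [log_neg ht ht1]) (by positivity)
    _ = t ^ 2 * t ^ (-ε) / ε := by field_simp
    _ = t ^ (2 - ε) / ε := by
        rw [← rpow_natCast, ← rpow_add ht]; norm_num [sub_eq_add_neg]

theorem log_abs_one_sub_sq_of_one_lt {t : ℝ} (ht : 1 < t) :
    log |1 - t ^ 2| = 2 * log t + log (1 - t⁻¹ ^ 2) := by
  have h0 : 0 < t := by linarith
  have h1 : t⁻¹ < 1 := inv_lt_one_of_one_lt₀ ht
  have h2 : 0 < t⁻¹ := by positivity
  have hu : 0 < 1 - t⁻¹ ^ 2 := by nlinarith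
  have h : |1 - t ^ 2| = t ^ 2 * (1 - t⁻¹ ^ 2) := by
    rw [abs_of_neg (by nlinarith)]; field_simp; ring
  rw [h, log_mul (by positivity) hu.ne', log_pow]
  norm_num

theorem measurable_log_mul_log_div_rpow (p : ℝ) :
    Measurable (fun t : ℝ => log |1 - t ^ 2| * log t / t ^ p) := by
  simp only [log_abs]
  fun_prop

theorem integrableOn_Ioo_log_mul_log_div_rpow {α : ℝ} (hα : α < 1) (hα0 : 0 < α) :
    IntegrableOn (fun t : ℝ => log |1 - t ^ 2| * log t / t ^ (1 + 2 * α)) (Ioo 0 1) := by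
  have hg : IntegrableOn (fun t : ℝ => t ^ (-α) / (1 - α)) (Ioo 0 1) :=
    ((intervalIntegral.integrableOn_Ioo_rpow_iff one_pos).2 (by linarith)).div_const _
  refine Integrable.mono' hg (measurable_log_mul_log_div_rpow _).aestronglyMeasurable ?_
  refine (ae_restrict_iff' measurableSet_Ioo).2 (ae_of_all _ fun t ⟨ht, ht1⟩ => ?_)
  have hu : 0 < 1 - t ^ 2 := by nlinarith
  have hpos : 0 ≤ log (1 - t ^ 2) * log t :=
    mul_nonneg_of_nonpos_of_nonpos (log_nonpos hu.le (by nlinarith)) (log_neg ht ht1).le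
  have hle := log_one_sub_sq_mul_log_le ht ht1 (ε := 1 - α) (by linarith) (by linarith)
  have hp : 0 < t ^ (1 + 2 * α) := rpow_pos_of_pos ht _
  rw [abs_of_pos hu, norm_of_nonneg (by positivity), div_le_iff₀ hp]
  refine hle.trans_eq ?_
  rw [div_mul_eq_mul_div, ← rpow_add ht]
  ring_nf

theorem integrableOn_Ioi_one_log_mul_log_div_rpow {α : ℝ} (hα : 0 < α) :
    IntegrableOn (fun t : ℝ => log |1 - t ^ 2| * log t / t ^ (1 + 2 * α)) (Ioi 1) := by
  have hg : IntegrableOn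
      (fun t : ℝ => 8 / α ^ 2 * t ^ (-1 - α) + t ^ (-1 - 2 * α)) (Ioi 1) :=
    ((integrableOn_Ioi_rpow_of_lt (by linarith) one_pos).const_mul _).add
      (integrableOn_Ioi_rpow_of_lt (by linarith) one_pos)
  refine Integrable.mono' hg (measurable_log_mul_log_div_rpow _).aestronglyMeasurable ?_
  refine (ae_restrict_iff' measurableSet_Ioi).2 (ae_of_all _ fun t ht => ?_)
  have ht1 : 1 < t := ht
  have ht0 : 0 < t := by linarith
  have hs : 0 < t⁻¹ := by positivity
  have hs1 : t⁻¹ < 1 := inv_lt_one_of_one_lt₀ ht1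
  have hl : 0 < log t := log_pos ht1
  have hM : log (1 - t⁻¹ ^ 2) ≤ 0 := log_nonpos (by nlinarith) (by nlinarith)
  have hML : log (1 - t⁻¹ ^ 2) * -log t ≤ 1 := by
    have h := log_one_sub_sq_mul_log_le hs hs1 one_pos le_rfl
    rw [log_inv, div_one] at h
    exact h.trans (rpow_le_one hs.le hs1.le (by norm_num))
  have hL : log t ≤ t ^ (α / 2) / (α / 2) := log_le_rpow_div ht0.le (by positivity)
  have hL2 : 2 * log t ^ 2 ≤ 8 / α ^ 2 * t ^ α := by
    have h : (t ^ (α / 2) / (α / 2)) ^ 2 = 4 / α ^ 2 * t ^ α := by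
      rw [div_pow, ← rpow_natCast (t ^ (α / 2)), ← rpow_mul ht0.le]
      norm_num
      field_simp
      norm_num
    have h' := pow_le_pow_left₀ hl.le hL 2
    rw [h] at h'
    linarith [show 8 / α ^ 2 * t ^ α = 2 * (4 / α ^ 2 * t ^ α) by ring]
  have hp : 0 < t ^ (1 + 2 * α) := rpow_pos_of_pos ht0 _
  rw [norm_div, norm_of_nonneg hp.le, div_le_iff₀ hp, log_abs_one_sub_sq_of_one_lt ht1]
  have e : (8 / α ^ 2 * t ^ (-1 - α) + t ^ (-1 - 2 * α)) * t ^ (1 + 2 * α)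
      = 8 / α ^ 2 * t ^ α + 1 := by
    rw [add_mul, mul_assoc, ← rpow_add ht0, ← rpow_add ht0]
    ring_nf
    simp [add_comm]
  rw [e, norm_eq_abs, abs_le]
  have hML0 : 0 ≤ log (1 - t⁻¹ ^ 2) * -log t :=
    mul_nonneg_of_nonpos_of_nonpos hM (by linarith)
  constructor <;> nlinarith

/-- The sum of the integrand and its image under `t ↦ t⁻¹` is positive. -/
theorem log_mul_log_add_inversion_pos {α t : ℝ} (hα : 0 < α) (ht : 0 < t) (ht1 : t ≠ 1) :
    0 < log |1 - t ^ 2| * log t / t ^ (1 + 2 * α) +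
      t ^ (-2 : ℝ) * (log |1 - t⁻¹ ^ 2| * log t⁻¹ / t⁻¹ ^ (1 + 2 * α)) := by
  have hp : 0 < t ^ (-1 - 2 * α) := rpow_pos_of_pos ht _
  have hq : 0 < t ^ (2 * α - 1) := rpow_pos_of_pos ht _
  have e1 : ∀ x, x / t ^ (1 + 2 * α) = x * t ^ (-1 - 2 * α) := fun x => by
    rw [div_eq_mul_inv, ← rpow_neg ht.le]; ring_nf
  have e2 : ∀ x, t ^ (-2 : ℝ) * (x / t⁻¹ ^ (1 + 2 * α)) = x * t ^ (2 * α - 1) := fun x => by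
    rw [inv_rpow ht.le, div_inv_eq_mul, mul_left_comm, ← rpow_add ht]; ring_nf
  rw [e1, e2, log_inv]
  rcases lt_or_gt_of_ne ht1 with h | h
  · have hl : log t < 0 := log_neg ht h
    have hu : 0 < 1 - t ^ 2 := by nlinarith
    have hM : log (1 - t ^ 2) ≤ 0 := log_nonpos hu.le (by nlinarith)
    have hi := log_abs_one_sub_sq_of_one_lt ((one_lt_inv₀ ht).2 h)
    rw [inv_inv, log_inv] at hi
    rw [hi, abs_of_pos hu]
    have hpq : t ^ (2 * α - 1) ≤ t ^ (-1 - 2 * α) :=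
      rpow_le_rpow_of_exponent_ge ht h.le (by linarith)
    have h1 := mul_nonneg (mul_nonneg_of_nonpos_of_nonpos hM hl.le) (sub_nonneg.2 hpq)
    have h2 := mul_pos (mul_pos_of_neg_of_neg hl hl) hq
    nlinarith
  · have hl : 0 < log t := log_pos h
    have hs : 0 < t⁻¹ := by positivity
    have hs1 : t⁻¹ < 1 := inv_lt_one_of_one_lt₀ h
    have hu : 0 < 1 - t⁻¹ ^ 2 := by nlinarith
    have hM : log (1 - t⁻¹ ^ 2) ≤ 0 := log_nonpos hu.le (by nlinarith)
    rw [log_abs_one_sub_sq_of_one_lt h, abs_of_pos hu]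
    have hpq : t ^ (-1 - 2 * α) ≤ t ^ (2 * α - 1) :=
      rpow_le_rpow_of_exponent_le h.le (by linarith)
    have h1 := mul_nonneg (mul_nonneg (neg_nonneg.2 hM) hl.le) (sub_nonneg.2 hpq)
    have h2 := mul_pos (mul_pos hl hl) hp
    nlinarith

theorem integrable_and_pos_log_log (α : ℝ) (hα : α ∈ Set.Ioo (0:ℝ) 1) :
    MeasureTheory.IntegrableOn
      (fun t : ℝ => Real.log |1 - t ^ 2| * Real.log t / t ^ (1 + 2 * α))
      (Set.Ioi (0:ℝ)) ∧
    0 < ∫ t in Set.Ioi (0:ℝ), Real.log |1 - t ^ 2| * Real.log t / t ^ (1 + 2 * α) := by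
  obtain ⟨h0, h1⟩ := hα
  set f : ℝ → ℝ := fun t => log |1 - t ^ 2| * log t / t ^ (1 + 2 * α) with hf
  have hfint : IntegrableOn f (Ioi 0) := by
    rw [← Ioc_union_Ioi_eq_Ioi zero_le_one]
    exact ((integrableOn_Ioc_iff_integrableOn_Ioo).2
      (integrableOn_Ioo_log_mul_log_div_rpow h1 h0)).union
      (integrableOn_Ioi_one_log_mul_log_div_rpow h0)
  refine ⟨hfint, ?_⟩
  have hfint' := (integrableOn_Ioi_comp_rpow_iff f (neg_ne_zero.2 one_ne_zero)).2 hfint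
  have heq := integral_comp_rpow_Ioi f (neg_ne_zero.2 one_ne_zero)
  have hpos : ∀ t ∈ Ioi (0 : ℝ), t ≠ 1 →
      0 < f t + (|(-1 : ℝ)| * t ^ (-1 - 1 : ℝ)) • f (t ^ (-1 : ℝ)) := by
    intro t ht ht1
    have h := log_mul_log_add_inversion_pos h0 ht ht1
    rw [rpow_neg_one]
    norm_num [hf] at h ⊢
    exact h
  have hne : ∀ᵐ t ∂(volume.restrict (Ioi (0 : ℝ))), t ≠ 1 :=
    ae_restrict_of_ae (Measure.ae_ne volume 1)
  have hpos_ae : ∀ᵐ t ∂(volume.restrict (Ioi (0 : ℝ))),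
      0 < f t + (|(-1 : ℝ)| * t ^ (-1 - 1 : ℝ)) • f (t ^ (-1 : ℝ)) := by
    filter_upwards [hne, ae_restrict_mem measurableSet_Ioi] with t h h' using hpos t h' h
  have hsum := integral_add hfint hfint'
  rw [heq] at hsum
  have key : 0 < ∫ t in Ioi (0 : ℝ),
      (f t + (|(-1 : ℝ)| * t ^ (-1 - 1 : ℝ)) • f (t ^ (-1 : ℝ))) := by
    rw [integral_pos_iff_support_of_nonneg_ae (hpos_ae.mono fun _ h => h.le) (hfint.add hfint')]
    refine lt_of_lt_of_le ?_ (measure_mono (s := Ioo 0 1) fun t ht => (hpos t ht.1 ht.2.ne).ne')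
    rw [Measure.restrict_apply measurableSet_Ioo,
      inter_eq_left.2 (Ioo_subset_Ioi_self : Ioo (0 : ℝ) 1 ⊆ Ioi 0)]
    simp
  linarith
end

section
/- For every α ∈ (0,1), the function T has a derivative at α equal to T'(α) = −2 ∫₀^∞ (log|1−t²|)(log t)/t^{1+2α} dt, and this derivative is strictly negative; consequently T is strictly decreasing on the interval (0,1). -/
open MeasureTheory Real Set

open Filter Topology Asymptotics in
theorem isBigO_log_abs_one_sub_sq_nhdsGT_zero :
    (fun t : ℝ => Real.log |1 - t ^ 2|) =O[𝓝[>] 0] fun t => t ^ (2 : ℝ) := by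
  have hd : HasDerivAt (fun u : ℝ => Real.log (1 - u)) (-1 / (1 - 0)) 0 :=
    ((hasDerivAt_id (0 : ℝ)).const_sub 1).log (by norm_num)
  have ht : Tendsto (fun t : ℝ => t ^ 2) (𝓝[>] 0) (𝓝 0) := by
    have : Tendsto (fun t : ℝ => t ^ 2) (𝓝 0) (𝓝 (0 ^ 2)) := (continuous_pow 2).tendsto 0
    exact (by simpa using this : Tendsto (fun t : ℝ => t ^ 2) (𝓝 0) (𝓝 0)).mono_left
      nhdsWithin_le_nhds
  simpa [Function.comp_def, Real.log_abs] using hd.isBigO_sub.comp_tendsto ht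

open Filter Topology Asymptotics in
theorem isBigO_log_abs_one_sub_sq_atTop {r : ℝ} (hr : 0 < r) :
    (fun t : ℝ => Real.log |1 - t ^ 2|) =O[atTop] fun t => t ^ r := by
  have ht : Tendsto (fun t : ℝ => t ^ 2 - 1) atTop atTop :=
    tendsto_atTop_add_const_right _ _ (tendsto_pow_atTop two_ne_zero)
  have h := (isLittleO_log_rpow_atTop (half_pos hr)).isBigO.comp_tendsto ht
  simp_rw [Real.log_abs, ← Real.log_neg_eq_log (1 - _), neg_sub]
  refine h.trans (IsBigO.of_bound 1 ?_)
  filter_upwards [eventually_ge_atTop 1] with t ht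
  have h1 : 0 ≤ t ^ 2 - 1 := by nlinarith
  have h0 : 0 ≤ t := by linarith
  simp only [Function.comp_apply, one_mul]
  rw [Real.norm_of_nonneg (by positivity), Real.norm_of_nonneg (by positivity)]
  calc (t ^ 2 - 1) ^ (r / 2) ≤ (t ^ 2) ^ (r / 2) := by gcongr; linarith
    _ = t ^ r := by
      rw [← Real.rpow_natCast, ← Real.rpow_mul h0]
      congr 1
      push_cast
      ring

theorem locallyIntegrable_log_abs_one_sub_sq :
    LocallyIntegrable (fun t : ℝ => Real.log |1 - t ^ 2|) := by
  have hi (a b : ℝ) : IntervalIntegrable (fun t : ℝ => Real.log |1 - t ^ 2|) volume a b := by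
    have hm : MeromorphicOn (fun t : ℝ => 1 - t ^ 2) (uIcc a b) := fun x _ => by fun_prop
    exact hm.intervalIntegrable_log_norm
  rw [locallyIntegrable_iff]
  intro k hk
  obtain ⟨a, ha⟩ := hk.bddBelow
  obtain ⟨b, hb⟩ := hk.bddAbove
  rcases k.eq_empty_or_nonempty with rfl | ⟨x, hx⟩
  · simp
  have hab : a ≤ b := (ha hx).trans (hb hx)
  exact ((intervalIntegrable_iff_integrableOn_Icc_of_le hab).1 (hi a b)).mono_set
    fun y hy => ⟨ha hy, hb hy⟩

theorem ofReal_cpow_mul_ofReal_eq_div_rpow {t : ℝ} (ht : 0 < t) (α c : ℝ) :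
    (t : ℂ) ^ (((-2 * α : ℝ) : ℂ) - 1) * (c : ℂ) = ((c / t ^ (1 + 2 * α) : ℝ) : ℂ) := by
  rw [← Complex.ofReal_one, ← Complex.ofReal_sub, ← Complex.ofReal_cpow ht.le,
    ← Complex.ofReal_mul, show -2 * α - 1 = -(1 + 2 * α) by ring, Real.rpow_neg ht.le, div_eq_mul_inv,
    mul_comm]

theorem mellin_ofReal_neg_two_mul (f : ℝ → ℝ) (α : ℝ) :
    mellin (fun t => (f t : ℂ)) ((-2 * α : ℝ) : ℂ) =
      ((∫ t in Ioi (0 : ℝ), f t / t ^ (1 + 2 * α) : ℝ) : ℂ) := by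
  rw [mellin, ← integral_complex_ofReal]
  exact setIntegral_congr_fun measurableSet_Ioi fun t ht =>
    ofReal_cpow_mul_ofReal_eq_div_rpow ht α (f t)

theorem integrableOn_and_hasDerivAt_T {α : ℝ} (hα : α ∈ Ioo (0 : ℝ) 1) :
    IntegrableOn (fun t : ℝ => Real.log |1 - t ^ 2| * Real.log t / t ^ (1 + 2 * α)) (Ioi 0) ∧
    HasDerivAt T
      (-2 * ∫ t in Ioi (0 : ℝ), Real.log |1 - t ^ 2| * Real.log t / t ^ (1 + 2 * α)) α := by
  obtain ⟨h0, h1⟩ := hα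
  let f : ℝ → ℝ := fun t => Real.log |1 - t ^ 2|
  have hlog : (fun t : ℝ => Real.log t • (f t : ℂ)) = fun t => ((f t * Real.log t : ℝ) : ℂ) := by
    ext t
    simp [mul_comm]
  have hloc : LocallyIntegrableOn (fun t => (f t : ℂ)) (Ioi 0) := by
    intro x _
    obtain ⟨s, hs, hfs⟩ := locallyIntegrable_log_abs_one_sub_sq x
    exact ⟨s, mem_nhdsWithin_of_mem_nhds hs, hfs.ofReal⟩
  obtain ⟨hconv, hderiv⟩ := mellin_hasDerivAt_of_isBigO_rpow (a := -α) (b := -2)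
    (s := ((-2 * α : ℝ) : ℂ)) hloc
    (by
      rw [neg_neg]
      exact Complex.isBigO_ofReal_left.2 (isBigO_log_abs_one_sub_sq_atTop h0))
    (by rw [Complex.ofReal_re]; linarith)
    (by
      rw [neg_neg]
      exact Complex.isBigO_ofReal_left.2 isBigO_log_abs_one_sub_sq_nhdsGT_zero)
    (by rw [Complex.ofReal_re]; linarith)
  rw [hlog] at hconv hderiv
  constructor
  · have hre : IntegrableOn (fun t : ℝ => ((f t * Real.log t / t ^ (1 + 2 * α) : ℝ) : ℂ))
        (Ioi 0) :=
      IntegrableOn.congr_fun hconv (fun t ht => ofReal_cpow_mul_ofReal_eq_div_rpow ht α _)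
        measurableSet_Ioi
    exact hre.re
  · rw [mellin_ofReal_neg_two_mul] at hderiv
    have hT : T = fun β : ℝ => (mellin (fun t => (f t : ℂ)) ((-2 * β : ℝ) : ℂ)).re := by
      ext β
      rw [mellin_ofReal_neg_two_mul, Complex.ofReal_re, T]
    have hc := hderiv.real_of_complex.comp α ((hasDerivAt_id α).const_mul (-2))
    rw [hT]
    simpa [Function.comp_def, f, mul_comm] using hc

theorem integrand_add_comp_inv_pos {α t : ℝ} (hα : 0 < α) (ht : 0 < t) (ht1 : t < 1) :
    0 < Real.log |1 - t ^ 2| * Real.log t / t ^ (1 + 2 * α) +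
      t ^ (-2 : ℝ) * (Real.log |1 - t⁻¹ ^ 2| * Real.log t⁻¹ / t⁻¹ ^ (1 + 2 * α)) := by
  have hl : Real.log t < 0 := Real.log_neg ht ht1
  have hpos : 0 < 1 - t ^ 2 := by nlinarith
  have hL : Real.log (1 - t ^ 2) < 0 := Real.log_neg hpos (by nlinarith)
  have hinv : Real.log |1 - t⁻¹ ^ 2| = Real.log (1 - t ^ 2) - 2 * Real.log t := by
    rw [Real.log_abs, ← Real.log_neg_eq_log,
      show -(1 - t⁻¹ ^ 2) = (1 - t ^ 2) / t ^ 2 by field_simp; ring,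
      Real.log_div hpos.ne' (by positivity), Real.log_pow]
    norm_num
  have hpow : t ^ (-2 : ℝ) / t⁻¹ ^ (1 + 2 * α) = t ^ (2 * α - 1) := by
    rw [Real.inv_rpow ht.le, ← Real.rpow_neg ht.le, ← Real.rpow_sub ht]
    congr 1
    ring
  have hlt : t ^ (2 * α - 1) < t ^ (-(1 + 2 * α)) :=
    Real.rpow_lt_rpow_of_exponent_gt ht ht1 (by linarith)
  have hp : 0 < t ^ (2 * α - 1) := Real.rpow_pos_of_pos ht _
  have key : Real.log |1 - t ^ 2| * Real.log t / t ^ (1 + 2 * α) +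
      t ^ (-2 : ℝ) * (Real.log |1 - t⁻¹ ^ 2| * Real.log t⁻¹ / t⁻¹ ^ (1 + 2 * α)) =
      Real.log (1 - t ^ 2) * Real.log t * (t ^ (-(1 + 2 * α)) - t ^ (2 * α - 1)) +
        2 * Real.log t ^ 2 * t ^ (2 * α - 1) := by
    rw [hinv, Real.log_inv, Real.log_abs, ← hpow, Real.rpow_neg ht.le (1 + 2 * α)]
    ring
  rw [key]
  exact add_pos (mul_pos (mul_pos_of_neg_of_neg hL hl) (sub_pos.2 hlt))
    (mul_pos (mul_pos two_pos (sq_pos_of_neg hl)) hp)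

theorem integral_log_mul_log_div_rpow_pos {α : ℝ} (hα : α ∈ Ioo (0 : ℝ) 1) :
    0 < ∫ t in Ioi (0 : ℝ), Real.log |1 - t ^ 2| * Real.log t / t ^ (1 + 2 * α) := by
  set g : ℝ → ℝ := fun t => Real.log |1 - t ^ 2| * Real.log t / t ^ (1 + 2 * α) with hg
  have hint : IntegrableOn g (Ioi 0) := (integrableOn_and_hasDerivAt_T hα).1
  have hcongr : EqOn (fun x : ℝ => (|(-1 : ℝ)| * x ^ ((-1 : ℝ) - 1)) • g (x ^ (-1 : ℝ)))
      (fun x => x ^ (-2 : ℝ) * g x⁻¹) (Ioi 0) := by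
    intro x _
    norm_num [Real.rpow_neg_one]
  have hint' : IntegrableOn (fun x => x ^ (-2 : ℝ) * g x⁻¹) (Ioi 0) :=
    ((integrableOn_Ioi_comp_rpow_iff g (by norm_num)).2 hint).congr_fun hcongr measurableSet_Ioi
  have heq : ∫ x in Ioi (0 : ℝ), x ^ (-2 : ℝ) * g x⁻¹ = ∫ x in Ioi (0 : ℝ), g x := by
    rw [← integral_comp_rpow_Ioi g (p := -1) (by norm_num)]
    exact (setIntegral_congr_fun measurableSet_Ioi hcongr).symm
  have hpos1 : ∀ t ∈ Ioo (0 : ℝ) 1, 0 < g t + t ^ (-2 : ℝ) * g t⁻¹ := fun t ht =>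
    integrand_add_comp_inv_pos hα.1 ht.1 ht.2
  have hnonneg : ∀ t ∈ Ioi (0 : ℝ), 0 ≤ g t + t ^ (-2 : ℝ) * g t⁻¹ := by
    intro t ht
    have ht : 0 < t := ht
    rcases lt_trichotomy t 1 with h | rfl | h
    · exact (hpos1 t ⟨ht, h⟩).le
    · simp [hg]
    · have h' := hpos1 t⁻¹ ⟨inv_pos.2 ht, inv_lt_one_of_one_lt₀ h⟩
      have hs : t ^ (-2 : ℝ) * t⁻¹ ^ (-2 : ℝ) = 1 := by
        rw [← Real.mul_rpow ht.le (inv_pos.2 ht).le, mul_inv_cancel₀ ht.ne', Real.one_rpow]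
      rw [inv_inv] at h'
      calc 0 ≤ t ^ (-2 : ℝ) * (g t⁻¹ + t⁻¹ ^ (-2 : ℝ) * g t) := by positivity
        _ = g t + t ^ (-2 : ℝ) * g t⁻¹ := by linear_combination g t * hs
  have hsum : 0 < ∫ t in Ioi (0 : ℝ), (g t + t ^ (-2 : ℝ) * g t⁻¹) := by
    rw [setIntegral_pos_iff_support_of_nonneg_ae
      (ae_restrict_of_forall_mem measurableSet_Ioi hnonneg) (hint.add hint')]
    refine lt_of_lt_of_le ?_ (measure_mono (s := Ioo (0 : ℝ) 1) fun t ht =>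
      ⟨(hpos1 t ht).ne', ht.1⟩)
    simp
  rw [integral_add hint hint', heq] at hsum
  linarith

theorem hasDerivAt_T :
    (∀ α ∈ Set.Ioo (0:ℝ) 1,
      HasDerivAt T
        (-2 * ∫ t in Set.Ioi (0:ℝ), Real.log |1 - t ^ 2| * Real.log t / t ^ (1 + 2 * α)) α ∧
      -2 * (∫ t in Set.Ioi (0:ℝ), Real.log |1 - t ^ 2| * Real.log t / t ^ (1 + 2 * α)) < 0) ∧
    StrictAntiOn T (Set.Ioo (0:ℝ) 1) := by
  have hmain : ∀ α ∈ Set.Ioo (0:ℝ) 1,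
      HasDerivAt T
        (-2 * ∫ t in Set.Ioi (0:ℝ), Real.log |1 - t ^ 2| * Real.log t / t ^ (1 + 2 * α)) α ∧
      -2 * (∫ t in Set.Ioi (0:ℝ), Real.log |1 - t ^ 2| * Real.log t / t ^ (1 + 2 * α)) < 0 :=
    fun α hα => ⟨(integrableOn_and_hasDerivAt_T hα).2, by
      linarith [integral_log_mul_log_div_rpow_pos hα]⟩
  refine ⟨hmain, strictAntiOn_of_deriv_neg (convex_Ioo 0 1)
    (fun α hα => (hmain α hα).1.continuousAt.continuousWithinAt) fun α hα => ?_⟩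
  rw [interior_Ioo] at hα
  rw [(hmain α hα).1.deriv]
  exact (hmain α hα).2
end

section
/- There exists a unique α₀ ∈ (0,1) such that T(α₀) = 0; moreover T(α) > 0 for every α ∈ (0,α₀) and T(α) < 0 for every α ∈ (α₀,1). -/
open MeasureTheory Real Set

theorem integrableOn_and_hasSum_integral_of_pos {S : Set ℝ} (hS : MeasurableSet S)
    {F : ℕ → ℝ → ℝ} {f : ℝ → ℝ} {c : ℕ → ℝ} (hF : ∀ n, IntegrableOn (F n) S)
    (hF0 : ∀ n, ∀ t ∈ S, 0 ≤ F n t) (hFc : ∀ n, ∫ t in S, F n t = c n)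
    (hc : ∀ n, 0 < c n) (hcs : Summable c) (hf : ∀ t ∈ S, HasSum (fun n => F n t) (f t)) :
    IntegrableOn f S ∧ HasSum c (∫ t in S, f t) := by
  have hnorm : (fun n => ∫ t in S, ‖F n t‖) = c := by
    funext n
    rw [← hFc n]
    exact setIntegral_congr_fun hS fun t ht => norm_of_nonneg (hF0 n t ht)
  have h := hasSum_integral_of_summable_integral_norm (μ := volume.restrict S) (F := F) hF
    (by rwa [hnorm])
  simp only [hFc] at h
  rw [setIntegral_congr_fun hS fun t ht => (hf t ht).tsum_eq] at h
  refine ⟨Integrable.of_integral_ne_zero ?_, h⟩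
  rw [← h.tsum_eq]
  exact (hcs.tsum_pos (fun n => (hc n).le) 0 (hc 0)).ne'

theorem summable_inv_succ_mul {b : ℝ} (hb : -1 < b) :
    Summable fun n : ℕ => 1 / (((n : ℝ) + 1) * (2 * n + 2 + 2 * b)) := by
  have h2 : Summable fun n : ℕ => 1 / ((n : ℝ) + 1) ^ 2 := by
    have := (summable_nat_add_iff 1).2 (Real.summable_one_div_nat_pow.2 one_lt_two)
    simpa using this
  have hm : 0 < min 1 (1 + b) := lt_min one_pos (by linarith)
  refine Summable.of_nonneg_of_le (fun n => ?_) (fun n => ?_) (h2.mul_left (1 / min 1 (1 + b)))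
  · have : (0 : ℝ) ≤ n := n.cast_nonneg
    have : 0 < 2 * (n : ℝ) + 2 + 2 * b := by linarith
    positivity
  · have hn : (0 : ℝ) ≤ n := n.cast_nonneg
    rw [← one_div_mul_one_div_rev, one_div_mul_one_div_rev, one_div_mul_one_div_rev]
    apply one_div_le_one_div_of_le (by positivity)
    have h1 := min_le_left 1 (1 + b)
    have h3 := min_le_right 1 (1 + b)
    have : ((n : ℝ) + 1) * min 1 (1 + b) ≤ 2 * n + 2 + 2 * b := by nlinarith
    nlinarith

theorem near_log_integral {α : ℝ} (hα : α < 1) :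
    IntegrableOn (fun t : ℝ => -log (1 - t ^ 2) / t ^ (1 + 2 * α)) (Ioo 0 1) ∧
    HasSum (fun n : ℕ => 1 / (((n : ℝ) + 1) * (2 * n + 2 + 2 * (-α))))
      (∫ t in Ioo (0 : ℝ) 1, -log (1 - t ^ 2) / t ^ (1 + 2 * α)) := by
  have hpos (n : ℕ) : 0 < 2 * (n : ℝ) + 2 + 2 * (-α) := by
    have : (0 : ℝ) ≤ n := n.cast_nonneg
    linarith
  refine integrableOn_and_hasSum_integral_of_pos measurableSet_Ioo
    (F := fun n t => t ^ (2 * (n : ℝ) + 1 - 2 * α) / ((n : ℝ) + 1))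
    (fun n => ?_) (fun n t ht => ?_) (fun n => ?_) (fun n => ?_)
    (summable_inv_succ_mul (by linarith)) (fun t ht => ?_)
  · have h := (intervalIntegral.intervalIntegrable_rpow' (a := 0) (b := 1)
      (r := 2 * (n : ℝ) + 1 - 2 * α) (by linarith [hpos n])).div_const ((n : ℝ) + 1)
    rw [intervalIntegrable_iff_integrableOn_Ioo_of_le zero_le_one] at h
    exact h
  · have := rpow_nonneg ht.1.le (2 * (n : ℝ) + 1 - 2 * α)
    positivity
  · rw [integral_div, ← integral_Ioc_eq_integral_Ioo, ← intervalIntegral.integral_of_le zero_le_one,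
      integral_rpow (Or.inl (by linarith [hpos n])), one_rpow,
      zero_rpow (by linarith [hpos n]), div_div, sub_zero]
    congr 1
    ring
  · have := hpos n
    positivity
  · have h := (hasSum_pow_div_log_of_abs_lt_one (x := t ^ 2)
      (by rw [abs_of_nonneg (sq_nonneg t)]; nlinarith [ht.1, ht.2])).div_const (t ^ (1 + 2 * α))
    convert! h using 2 with n
    rw [div_right_comm, ← pow_mul, ← rpow_natCast, ← rpow_sub ht.1]
    congr 2
    push_cast
    ring

theorem far_log_integral {α : ℝ} (hα : 0 < α) :
    IntegrableOn (fun t : ℝ => -log (1 - (t ^ 2)⁻¹) / t ^ (1 + 2 * α)) (Ioi 1) ∧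
    HasSum (fun n : ℕ => 1 / (((n : ℝ) + 1) * (2 * n + 2 + 2 * α)))
      (∫ t in Ioi (1 : ℝ), -log (1 - (t ^ 2)⁻¹) / t ^ (1 + 2 * α)) := by
  have hpos (n : ℕ) : 0 < 2 * (n : ℝ) + 2 + 2 * α := by
    have : (0 : ℝ) ≤ n := n.cast_nonneg
    linarith
  refine integrableOn_and_hasSum_integral_of_pos measurableSet_Ioi
    (F := fun n t => t ^ (-(2 * (n : ℝ) + 2 + 2 * α) - 1) / ((n : ℝ) + 1))
    (fun n => ?_) (fun n t ht => ?_) (fun n => ?_) (fun n => ?_)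
    (summable_inv_succ_mul (by linarith)) (fun t ht => ?_)
  · exact (integrableOn_Ioi_rpow_of_lt (by linarith [hpos n]) one_pos).div_const _
  · have := rpow_nonneg (zero_le_one.trans (mem_Ioi.1 ht).le) (-(2 * (n : ℝ) + 2 + 2 * α) - 1)
    positivity
  · rw [integral_div, integral_Ioi_rpow_of_lt (by linarith [hpos n]) one_pos, one_rpow,
      sub_add_cancel, neg_div_neg_eq, div_div, mul_comm]
  · have := hpos n
    positivity
  · have ht1 : 1 < t := ht
    have ht0 : 0 < t := by linarith
    have h := (hasSum_pow_div_log_of_abs_lt_one (x := (t ^ 2)⁻¹)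
      (by rw [abs_of_pos (by positivity)]; exact inv_lt_one_of_one_lt₀ (by nlinarith))).div_const
        (t ^ (1 + 2 * α))
    convert! h using 2 with n
    rw [div_right_comm, inv_pow, ← pow_mul, ← rpow_natCast, ← rpow_neg ht0.le, ← rpow_sub ht0]
    congr 2
    push_cast
    ring

theorem log_rpow_integral {α : ℝ} (hα : 0 < α) :
    IntegrableOn (fun t : ℝ => 2 * log t / t ^ (1 + 2 * α)) (Ioi 1) ∧
    ∫ t in Ioi (1 : ℝ), 2 * log t / t ^ (1 + 2 * α) = 1 / (2 * α ^ 2) := by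
  have hd : ∀ t ∈ Ici (1 : ℝ), HasDerivAt
      (fun t : ℝ => -(log t * t ^ (-(2 * α))) / α - t ^ (-(2 * α)) / (2 * α ^ 2))
      (2 * log t / t ^ (1 + 2 * α)) t := by
    intro t ht
    have ht0 : 0 < t := one_pos.trans_le ht
    have hr := hasDerivAt_rpow_const (x := t) (p := -(2 * α)) (Or.inl ht0.ne')
    convert! (((hasDerivAt_log ht0.ne').mul hr).neg.div_const α).sub
      (hr.div_const (2 * α ^ 2)) using 1
    rw [rpow_sub_one ht0.ne', rpow_add ht0, rpow_one, rpow_neg ht0.le]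
    field_simp
    ring
  have h0 : ∀ t ∈ Ioi (1 : ℝ), 0 ≤ 2 * log t / t ^ (1 + 2 * α) := fun t ht => by
    have := log_nonneg (mem_Ioi.1 ht).le
    have := rpow_nonneg (zero_le_one.trans (mem_Ioi.1 ht).le) (1 + 2 * α)
    positivity
  have hl : Filter.Tendsto
      (fun t : ℝ => -(log t * t ^ (-(2 * α))) / α - t ^ (-(2 * α)) / (2 * α ^ 2))
      Filter.atTop (nhds 0) := by
    have h1 := tendsto_rpow_neg_atTop (y := 2 * α) (by positivity)
    have h2 : Filter.Tendsto (fun t : ℝ => log t * t ^ (-(2 * α))) Filter.atTop (nhds 0) := by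
      refine (isLittleO_log_rpow_atTop (r := 2 * α) (by positivity)).tendsto_div_nhds_zero.congr' ?_
      filter_upwards [Filter.eventually_gt_atTop 0] with t ht
      rw [rpow_neg ht.le, div_eq_mul_inv]
    simpa using (h2.neg.div_const α).sub (h1.div_const (2 * α ^ 2))
  refine ⟨integrableOn_Ioi_deriv_of_nonneg' hd h0 hl, ?_⟩
  rw [integral_Ioi_of_hasDerivAt_of_nonneg' hd h0 hl]
  simp

theorem hasSum_T {α : ℝ} (h0 : 0 < α) (h1 : α < 1) :
    HasSum (fun n : ℕ => 1 / (((n : ℝ) + 1) ^ 2 - α ^ 2)) (1 / (2 * α ^ 2) - T α) := by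
  obtain ⟨hi1, hs1⟩ := near_log_integral h1
  obtain ⟨hi2, hs2⟩ := far_log_integral h0
  obtain ⟨hi3, hs3⟩ := log_rpow_integral h0
  have e1 : EqOn (fun t : ℝ => -(-log (1 - t ^ 2) / t ^ (1 + 2 * α)))
      (fun t => log |1 - t ^ 2| / t ^ (1 + 2 * α)) (Ioo 0 1) := fun t ht => by
    simp only [log_abs]
    ring
  have e2 : EqOn (fun t : ℝ => 2 * log t / t ^ (1 + 2 * α) -
      -log (1 - (t ^ 2)⁻¹) / t ^ (1 + 2 * α))
      (fun t => log |1 - t ^ 2| / t ^ (1 + 2 * α)) (Ioi 1) := fun t ht => by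
    have ht1 : 1 < t := ht
    have ht0 : 0 < t := by linarith
    have hinv : (t ^ 2)⁻¹ < 1 := inv_lt_one_of_one_lt₀ (by nlinarith)
    have : log |1 - t ^ 2| = 2 * log t + log (1 - (t ^ 2)⁻¹) := by
      rw [log_abs, ← log_neg_eq_log, show -(1 - t ^ 2) = t ^ 2 * (1 - (t ^ 2)⁻¹) by field_simp; ring,
        log_mul (by positivity) (by linarith), log_pow]
      norm_num
    simp only [this]
    ring
  have hT : T α = -(∫ t in Ioo (0 : ℝ) 1, -log (1 - t ^ 2) / t ^ (1 + 2 * α)) +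
      (1 / (2 * α ^ 2) - ∫ t in Ioi (1 : ℝ), -log (1 - (t ^ 2)⁻¹) / t ^ (1 + 2 * α)) := by
    rw [T, ← Ioc_union_Ioi_eq_Ioi (zero_le_one' ℝ),
      setIntegral_union (Ioc_disjoint_Ioi le_rfl) measurableSet_Ioi
        ((integrableOn_Ioc_iff_integrableOn_Ioo (by simp)).2 (hi1.neg.congr_fun e1 measurableSet_Ioo))
        ((hi3.sub hi2).congr_fun e2 measurableSet_Ioi),
      integral_Ioc_eq_integral_Ioo, ← setIntegral_congr_fun measurableSet_Ioo e1,
      ← setIntegral_congr_fun measurableSet_Ioi e2, integral_neg, integral_sub hi3 hi2, hs3]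
  convert! hs1.add hs2 using 1
  · funext n
    have hn : (0 : ℝ) ≤ n := n.cast_nonneg
    have ha : (n : ℝ) + 1 - α ≠ 0 := by linarith
    have hb : (n : ℝ) + 1 + α ≠ 0 := by linarith
    have hc : ((n : ℝ) + 1) ^ 2 - α ^ 2 = (n + 1 - α) * (n + 1 + α) := by ring
    rw [hc, show 2 * (n : ℝ) + 2 + 2 * (-α) = 2 * (n + 1 - α) by ring,
      show 2 * (n : ℝ) + 2 + 2 * α = 2 * (n + 1 + α) by ring]
    field_simp
    ring
  · rw [hT]
    ring

theorem T_eq {α : ℝ} (h0 : 0 < α) (h1 : α < 1) :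
    T α = π * cos (π * α) / (2 * α * sin (π * α)) := by
  have hmem : (α : ℂ) ∈ Complex.integerComplement := by
    rintro ⟨k, hk⟩
    have hk' : (k : ℝ) = α := by exact_mod_cast hk
    have a : (0 : ℝ) < k := hk' ▸ h0
    have b : (k : ℝ) < 1 := hk' ▸ h1
    norm_cast at a b
    omega
  have hs : sin (π * α) ≠ 0 :=
    (sin_pos_of_pos_of_lt_pi (by positivity) (by nlinarith [pi_pos])).ne'
  have hsum := Complex.hasSum_ofReal.2 ((hasSum_T h0 h1).mul_left (-(2 * α)))
  have hterm : (fun n : ℕ => ((-(2 * α) * (1 / (((n : ℝ) + 1) ^ 2 - α ^ 2)) : ℝ) : ℂ)) =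
      fun n : ℕ => (1 / ((α : ℂ) - (n + 1)) + 1 / ((α : ℂ) + (n + 1))) := by
    funext n
    have hn : (0 : ℝ) ≤ n := n.cast_nonneg
    have ha : α - ((n : ℝ) + 1) ≠ 0 := by linarith
    have hb : α + ((n : ℝ) + 1) ≠ 0 := by linarith
    have : -(2 * α) * (1 / (((n : ℝ) + 1) ^ 2 - α ^ 2)) =
        1 / (α - (n + 1)) + 1 / (α + (n + 1)) := by
      rw [show ((n : ℝ) + 1) ^ 2 - α ^ 2 = -((α - (n + 1)) * (α + (n + 1))) by ring]
      field_simp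
      ring
    rw [this]
    push_cast
    rfl
  rw [hterm] at hsum
  have h := cot_series_rep' hmem
  rw [hsum.tsum_eq, Complex.cot] at h
  have h' : π * (cos (π * α) / sin (π * α)) - 1 / α = -(2 * α) * (1 / (2 * α ^ 2) - T α) := by
    exact_mod_cast h
  field_simp at h' ⊢
  apply mul_left_cancel₀ h0.ne'
  linear_combination -h'

theorem exists_unique_zero_T :
    ∃ α₀ ∈ Set.Ioo (0:ℝ) 1, T α₀ = 0 ∧
      (∀ α ∈ Set.Ioo (0:ℝ) α₀, 0 < T α) ∧
      (∀ α ∈ Set.Ioo α₀ (1:ℝ), T α < 0) ∧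
      (∀ α ∈ Set.Ioo (0:ℝ) 1, T α = 0 → α = α₀) := by
  have hsin {α : ℝ} (h0 : 0 < α) (h1 : α < 1) : 0 < sin (π * α) :=
    sin_pos_of_pos_of_lt_pi (by positivity) (by nlinarith [pi_pos])
  have hpos : ∀ α ∈ Ioo (0 : ℝ) (1 / 2), 0 < T α := fun α ⟨h0, h1⟩ => by
    have hs := hsin h0 (by linarith)
    have hc : 0 < cos (π * α) :=
      cos_pos_of_mem_Ioo ⟨by nlinarith [pi_pos], by nlinarith [pi_pos]⟩
    rw [T_eq h0 (by linarith)]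
    positivity
  have hneg : ∀ α ∈ Ioo (1 / 2 : ℝ) 1, T α < 0 := fun α ⟨h0, h1⟩ => by
    have h0' : 0 < α := by linarith
    have hs := hsin h0' h1
    have hc : cos (π * α) < 0 :=
      cos_neg_of_pi_div_two_lt_of_lt (by nlinarith [pi_pos]) (by nlinarith [pi_pos])
    rw [T_eq h0' h1]
    exact div_neg_of_neg_of_pos (mul_neg_of_pos_of_neg pi_pos hc) (by positivity)
  refine ⟨1 / 2, ⟨by norm_num, by norm_num⟩, ?_, hpos, hneg, fun α hα h => ?_⟩
  · rw [T_eq (by norm_num) (by norm_num), mul_one_div, cos_pi_div_two]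
    simp
  · rcases lt_trichotomy α (1 / 2) with hlt | heq | hgt
    · exact absurd h (hpos α ⟨hα.1, hlt⟩).ne'
    · exact heq
    · exact absurd h (hneg α ⟨hgt, hα.2⟩).ne
end
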